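/- arXiv:1204.5332 — 2 statements merged into one kernel-verified Lean document; each statement's English description precedes it below -/
import Mathlib

section
/- Let V belong to the class 𝒱 and satisfy condition (K). If the quadratic form Q_V is not weakly coercive, then the supremum of ∫_B e^{4π u(x)²} dx over all u ∈ C_c^∞(B) with Q_V(u) ≤ 1 is infinite; that is, for every C > 0 there exists u ∈ C_c^∞(B) with Q_V(u) ≤ 1 and ∫_B e^{4π u(x)²} dx > C. -/
open MeasureTheory Real Set Filter
open scoped ENNReal

noncomputable section

abbrev E2 := EuclideanSpace ℝ (Fin 2)

/-- The open unit disk in ℝ². -/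
def unitDisk : Set E2 := Metric.ball 0 1

/-- `u ∈ C_c^∞(Ω)`: smooth with compact support contained in `Ω`. -/
def IsTestFun (Ω : Set E2) (u : E2 → ℝ) : Prop :=
  ContDiff ℝ (⊤ : ℕ∞) u ∧ IsCompact (tsupport u) ∧ tsupport u ⊆ Ω

/-- The quadratic form `Q_V(u) = ∫_B |∇u|² - ∫_B V(|x|) u²`. -/
def QV (V : ℝ → ℝ) (u : E2 → ℝ) : ℝ :=
  (∫ x in unitDisk, ‖fderiv ℝ u x‖ ^ 2) - ∫ x in unitDisk, V ‖x‖ * u x ^ 2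

/-- Weak coercivity of `Q_V`. -/
def WeaklyCoercive (V : ℝ → ℝ) : Prop :=
  ∃ E : Set E2, IsOpen E ∧ IsCompact (closure E) ∧ closure E ⊆ unitDisk ∧
    ∃ δ : ℝ, 0 < δ ∧ ∀ u : E2 → ℝ, IsTestFun unitDisk u →
      δ * (∫ x in E, u x) ^ 2 ≤ QV V u

/-- The class 𝒱 of radial potentials. -/
def MemClassV (V : ℝ → ℝ) : Prop :=
  ContinuousOn V (Ioo 0 1) ∧ (∀ r ∈ Ioo (0:ℝ) 1, 0 ≤ V r) ∧
    AntitoneOn (fun r => (1 - r ^ 2) ^ 2 * V r) (Ioo 0 1)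

/-- Condition (K): `r² (log(1/r))^{2+α} V(r) → 0` as `r → 0⁺`, for some `α > 0`. -/
def CondK (V : ℝ → ℝ) : Prop :=
  ∃ α : ℝ, 0 < α ∧
    Tendsto (fun r : ℝ => r ^ 2 * Real.log (1 / r) ^ (2 + α) * V r)
      (nhdsWithin 0 (Ioi 0)) (nhds 0)

lemma IsTestFun.const_mul {Ω : Set E2} {u : E2 → ℝ} (hu : IsTestFun Ω u) (t : ℝ) :
    IsTestFun Ω (fun x => t * u x) := by
  have hsub : tsupport (fun x => t * u x) ⊆ tsupport u := tsupport_mul_subset_right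
  exact ⟨contDiff_const.mul hu.1, hu.2.1.of_isClosed_subset (isClosed_tsupport _) hsub,
    hsub.trans hu.2.2⟩

lemma QV_const_mul (V : ℝ → ℝ) {u : E2 → ℝ} (hu : Differentiable ℝ u) (t : ℝ) :
    QV V (fun x => t * u x) = t ^ 2 * QV V u := by
  have hgrad : ∀ x, ‖fderiv ℝ (fun y => t * u y) x‖ ^ 2 = t ^ 2 * ‖fderiv ℝ u x‖ ^ 2 := by
    intro x
    rw [fderiv_const_mul (hu x), norm_smul, mul_pow, Real.norm_eq_abs, sq_abs]
  have hpot : ∀ x, V ‖x‖ * (t * u x) ^ 2 = t ^ 2 * (V ‖x‖ * u x ^ 2) := fun x => by ring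
  simp only [QV, hgrad, hpot, integral_const_mul, mul_sub]

lemma sq_setIntegral_le_measure_mul {X : Type*} [MeasurableSpace X] {μ : Measure X} {E : Set X}
    {f : X → ℝ} (hE : μ E ≠ ∞) (hf : IntegrableOn f E μ)
    (hf2 : IntegrableOn (fun x => f x ^ 2) E μ) :
    (∫ x in E, f x ∂μ) ^ 2 ≤ μ.real E * ∫ x in E, f x ^ 2 ∂μ := by
  have h1 : IntegrableOn (fun _ : X => (1 : ℝ)) E μ := integrableOn_const hE
  have key : ∀ m : ℝ,
      0 ≤ μ.real E * (m * m) + (-2 * ∫ x in E, f x ∂μ) * m + ∫ x in E, f x ^ 2 ∂μ := by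
    intro m
    have hlin : IntegrableOn (fun x => m * m * 1 + (-2 * m) * f x) E μ :=
      (h1.const_mul _).add (hf.const_mul _)
    calc (0 : ℝ) ≤ ∫ x in E, (f x - m) ^ 2 ∂μ := integral_nonneg fun x => sq_nonneg _
      _ = ∫ x in E, (m * m * 1 + (-2 * m) * f x) + f x ^ 2 ∂μ := by
          congr 1; ext x; ring
      _ = _ := by
          rw [integral_add hlin hf2,
            integral_add (h1.const_mul _) (hf.const_mul _), integral_const_mul,
            integral_const_mul, setIntegral_const]
          simp only [smul_eq_mul]
          ring
  have := discrim_le_zero key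
  unfold discrim at this
  nlinarith

lemma IsTestFun.setIntegral_sq_pos {Ω : Set E2} {u : E2 → ℝ} (hu : IsTestFun Ω u)
    (h0 : u ≠ 0) : 0 < ∫ x in Ω, u x ^ 2 := by
  obtain ⟨x, hx⟩ := Function.ne_iff.mp h0
  have hsupp : ∀ y, y ∉ Ω → u y ^ 2 = 0 := fun y hy => by
    rw [image_eq_zero_of_notMem_tsupport fun h => hy (hu.2.2 h), sq, mul_zero]
  rw [setIntegral_eq_integral_of_forall_compl_eq_zero hsupp]
  have hc : HasCompactSupport u := hu.2.1
  have hcont : Continuous fun y => u y ^ 2 := hu.1.continuous.pow 2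
  have hc2 : HasCompactSupport fun y => u y ^ 2 :=
    hc.comp_left (g := fun y : ℝ => y ^ 2) (by simp)
  have hx2 : u x ^ 2 ≠ 0 := pow_ne_zero 2 hx
  exact hcont.integral_pos_of_hasCompactSupport_nonneg_nonzero hc2 (fun y => sq_nonneg (u y)) hx2

lemma Continuous.integrableOn_unitDisk {f : E2 → ℝ} (hf : Continuous f) :
    IntegrableOn f unitDisk :=
  (hf.continuousOn.integrableOn_compact (isCompact_closedBall 0 1)).mono_set
    Metric.ball_subset_closedBall

lemma setIntegral_sq_lt_setIntegral_exp {u : E2 → ℝ} (hu : Continuous u) :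
    4 * π * ∫ x in unitDisk, u x ^ 2 < ∫ x in unitDisk, Real.exp (4 * π * u x ^ 2) := by
  have hvol : 0 < volume.real unitDisk :=
    ENNReal.toReal_pos (Metric.measure_ball_pos _ _ one_pos).ne' measure_ball_lt_top.ne
  calc 4 * π * ∫ x in unitDisk, u x ^ 2
      < (∫ x in unitDisk, 4 * π * u x ^ 2) + ∫ _x in unitDisk, (1 : ℝ) := by
        rw [integral_const_mul, setIntegral_const]
        simpa using hvol
    _ = ∫ x in unitDisk, (4 * π * u x ^ 2 + 1) :=
        (integral_add (by fun_prop : Continuous fun x => 4 * π * u x ^ 2).integrableOn_unitDisk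
          continuous_const.integrableOn_unitDisk).symm
    _ ≤ _ := integral_mono (by fun_prop : Continuous _).integrableOn_unitDisk
        (by fun_prop : Continuous _).integrableOn_unitDisk fun x => Real.add_one_le_exp _

/-- Without weak coercivity, `Q_V` is not bounded below by any positive multiple of the squared
`L²` norm. -/
lemma exists_QV_lt_of_not_weaklyCoercive {V : ℝ → ℝ} (hwc : ¬ WeaklyCoercive V) {ε : ℝ}
    (hε : 0 < ε) :
    ∃ u : E2 → ℝ, IsTestFun unitDisk u ∧ u ≠ 0 ∧ QV V u < ε * ∫ x in unitDisk, u x ^ 2 := by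
  set E : Set E2 := Metric.ball 0 (1 / 2) with hE
  have hvol : 0 < volume.real E :=
    ENNReal.toReal_pos (Metric.measure_ball_pos _ _ (by norm_num)).ne' measure_ball_lt_top.ne
  have hEB : E ⊆ unitDisk := Metric.ball_subset_ball (by norm_num)
  by_contra! hcon
  refine hwc ⟨E, Metric.isOpen_ball, ?_, ?_, ε / volume.real E, by positivity, fun u hu => ?_⟩
  · exact (isCompact_closedBall (0 : E2) (1 / 2)).of_isClosed_subset isClosed_closure
      Metric.closure_ball_subset_closedBall
  · exact Metric.closure_ball_subset_closedBall.trans (Metric.closedBall_subset_ball (by norm_num))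
  by_cases h0 : u = 0
  · simp [h0, QV]
  have hcont := hu.1.continuous
  have hint2 : IntegrableOn (fun x => u x ^ 2) unitDisk := (hcont.pow 2).integrableOn_unitDisk
  calc ε / volume.real E * (∫ x in E, u x) ^ 2
      ≤ ε / volume.real E * (volume.real E * ∫ x in E, u x ^ 2) := by
        gcongr
        exact sq_setIntegral_le_measure_mul measure_ball_lt_top.ne
          (hcont.integrableOn_unitDisk.mono_set hEB) (hint2.mono_set hEB)
    _ = ε * ∫ x in E, u x ^ 2 := by field_simp
    _ ≤ ε * ∫ x in unitDisk, u x ^ 2 := by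
        gcongr
        exact ae_of_all _ fun x => sq_nonneg (u x)
    _ ≤ QV V u := hcon u hu h0

/-- If `V ∈ 𝒱` satisfies (K) and `Q_V` is NOT weakly coercive, then the
Trudinger-Moser supremum under the constraint `Q_V(u) ≤ 1` is infinite. -/
theorem trudinger_moser_remainder_infinite_of_not_weaklyCoercive (V : ℝ → ℝ)
    (hV : MemClassV V) (hK : CondK V) (hwc : ¬ WeaklyCoercive V) :
    ∀ C : ℝ, 0 < C → ∃ u : E2 → ℝ, IsTestFun unitDisk u ∧ QV V u ≤ 1 ∧
      C < ∫ x in unitDisk, Real.exp (4 * π * u x ^ 2) := by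
  intro C hC
  obtain ⟨u, hu, h0, hQ⟩ := exists_QV_lt_of_not_weaklyCoercive hwc
    (ε := 4 * π / C) (by positivity)
  have hJ := hu.setIntegral_sq_pos h0
  set J := ∫ x in unitDisk, u x ^ 2
  set t := √(C / (4 * π * J))
  have ht : t ^ 2 = C / (4 * π * J) := Real.sq_sqrt (by positivity)
  refine ⟨fun x => t * u x, hu.const_mul t, ?_, ?_⟩
  · rw [QV_const_mul V (hu.1.differentiable (by simp)), ht]
    calc C / (4 * π * J) * QV V u ≤ C / (4 * π * J) * (4 * π / C * J) := by gcongr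
      _ = 1 := by field_simp
  · refine lt_of_eq_of_lt ?_ (setIntegral_sq_lt_setIntegral_exp (hu.const_mul t).1.continuous)
    simp only [mul_pow, integral_const_mul, ht]
    change C = 4 * π * (C / (4 * π * J) * J)
    field_simp
end
end

section
/- Let V belong to the class 𝒱. Then the supremum of ∫_B e^{4π u(x)²} dx over all u ∈ C_c^∞(B) with Q_V(u) ≤ 1 equals (as an element of [0,∞]) the supremum of ∫_B e^{4π u(x)²} dx over all radially symmetric u ∈ C_c^∞(B) with Q_V(u) ≤ 1, where u is called radially symmetric if there is f : ℝ → ℝ with u(x) = f(|x|) for all x. -/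
open MeasureTheory Real Set Filter
open scoped ENNReal

noncomputable section

namespace HypSymm

open EuclideanGeometry
open scoped Topology NNReal

/-- The reflection of the Poincaré disk across the geodesic centred at `a`, `1 < ‖a‖`. -/
def hypRefl (a x : E2) : E2 := inversion a (√(‖a‖ ^ 2 - 1)) x

/-- `sinh² (d / 2)`, where `d` is the hyperbolic distance between `x` and `y`. -/
def hypSep (x y : E2) : ℝ := ‖x - y‖ ^ 2 / ((1 - ‖x‖ ^ 2) * (1 - ‖y‖ ^ 2))

lemma mem_unitDisk {x : E2} : x ∈ unitDisk ↔ ‖x‖ < 1 := by simp [unitDisk]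

lemma measurableSet_unitDisk : MeasurableSet unitDisk := Metric.isOpen_ball.measurableSet

lemma one_sub_sq_pos {x : E2} (hx : x ∈ unitDisk) : 0 < 1 - ‖x‖ ^ 2 := by
  rw [mem_unitDisk] at hx
  nlinarith [norm_nonneg x]

lemma hypSep_comm (x y : E2) : hypSep x y = hypSep y x := by
  rw [hypSep, hypSep, norm_sub_rev, mul_comm]

lemma radius_sq_pos {a : E2} (ha : 1 < ‖a‖) : 0 < ‖a‖ ^ 2 - 1 := by nlinarith

lemma norm_sub_center_pos {a x : E2} (ha : 1 < ‖a‖) (hx : x ∈ unitDisk) : 0 < ‖x - a‖ := by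
  have : x - a ≠ 0 := by
    rw [sub_ne_zero]
    rintro rfl
    exact absurd (mem_unitDisk.1 hx) (by linarith)
  positivity

lemma hypRefl_eq {a : E2} (ha : 1 < ‖a‖) (x : E2) :
    hypRefl a x = ((‖a‖ ^ 2 - 1) / ‖x - a‖ ^ 2) • (x - a) + a := by
  simp [hypRefl, inversion, dist_eq_norm, div_pow, Real.sq_sqrt (radius_sq_pos ha).le]

lemma hypRefl_hypRefl {a : E2} (ha : 1 < ‖a‖) (x : E2) : hypRefl a (hypRefl a x) = x :=
  inversion_inversion a (Real.sqrt_pos.2 (radius_sq_pos ha)).ne' x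

lemma one_sub_hypRefl {a x : E2} (ha : 1 < ‖a‖) (hx : x ∈ unitDisk) :
    1 - ‖hypRefl a x‖ ^ 2 = (‖a‖ ^ 2 - 1) / ‖x - a‖ ^ 2 * (1 - ‖x‖ ^ 2) := by
  have hp := norm_sub_center_pos ha hx
  have h1 : ‖x‖ ^ 2 = ‖x - a‖ ^ 2 + 2 * inner ℝ (x - a) a + ‖a‖ ^ 2 := by
    rw [← norm_add_sq_real, sub_add_cancel]
  rw [hypRefl_eq ha, norm_add_sq_real, norm_smul, inner_smul_left, mul_pow, Real.norm_eq_abs,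
    sq_abs, h1]
  simp only [conj_trivial]
  field_simp
  ring

lemma hypRefl_mem {a x : E2} (ha : 1 < ‖a‖) (hx : x ∈ unitDisk) : hypRefl a x ∈ unitDisk := by
  have h := one_sub_hypRefl ha hx
  have h2 : 0 < (‖a‖ ^ 2 - 1) / ‖x - a‖ ^ 2 * (1 - ‖x‖ ^ 2) :=
    mul_pos (div_pos (radius_sq_pos ha) (pow_pos (norm_sub_center_pos ha hx) 2)) (one_sub_sq_pos hx)
  rw [mem_unitDisk]
  nlinarith [norm_nonneg (hypRefl a x)]

lemma norm_hypRefl_sub {a x : E2} (ha : 1 < ‖a‖) (hx : x ∈ unitDisk) :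
    ‖hypRefl a x - a‖ ^ 2 = (‖a‖ ^ 2 - 1) ^ 2 / ‖x - a‖ ^ 2 := by
  have hp := norm_sub_center_pos ha hx
  rw [hypRefl_eq ha, add_sub_cancel_right, norm_smul, mul_pow, Real.norm_eq_abs, sq_abs]
  field_simp

lemma hypSep_hypRefl_right {a x y : E2} (ha : 1 < ‖a‖) (hx : x ∈ unitDisk) (hy : y ∈ unitDisk) :
    hypSep x (hypRefl a y) = hypSep x y +
      (‖x - a‖ ^ 2 - (‖a‖ ^ 2 - 1)) * (‖y - a‖ ^ 2 - (‖a‖ ^ 2 - 1)) /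
        ((1 - ‖x‖ ^ 2) * (1 - ‖y‖ ^ 2) * (‖a‖ ^ 2 - 1)) := by
  have hp := norm_sub_center_pos ha hy
  have hR := radius_sq_pos ha
  have hA := one_sub_sq_pos hx
  have hB := one_sub_sq_pos hy
  have h1 : ‖x - y‖ ^ 2 = ‖x - a‖ ^ 2 - 2 * inner ℝ (x - a) (y - a) + ‖y - a‖ ^ 2 := by
    rw [← norm_sub_sq_real, sub_sub_sub_cancel_right]
  have h2 : ‖x - hypRefl a y‖ ^ 2 = ‖x - a‖ ^ 2 -
      2 * ((‖a‖ ^ 2 - 1) / ‖y - a‖ ^ 2 * inner ℝ (x - a) (y - a)) +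
        (‖a‖ ^ 2 - 1) ^ 2 / ‖y - a‖ ^ 2 := by
    rw [hypRefl_eq ha, add_comm _ a, ← sub_sub, norm_sub_sq_real, inner_smul_right, norm_smul,
      mul_pow, Real.norm_eq_abs, sq_abs]
    field_simp
  rw [hypSep, hypSep, one_sub_hypRefl ha hy, h2, h1]
  field_simp
  ring

lemma hypSep_hypRefl {a x y : E2} (ha : 1 < ‖a‖) (hx : x ∈ unitDisk) (hy : y ∈ unitDisk) :
    hypSep (hypRefl a x) (hypRefl a y) = hypSep x y := by
  have hp := norm_sub_center_pos ha hx
  have hq := norm_sub_center_pos ha hy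
  have hR := radius_sq_pos ha
  have hA := one_sub_sq_pos hx
  have hB := one_sub_sq_pos hy
  rw [hypSep_hypRefl_right ha (hypRefl_mem ha hx) hy, hypSep_comm _ y,
    hypSep_hypRefl_right ha hy hx, hypSep_comm y x, one_sub_hypRefl ha hx, norm_hypRefl_sub ha hx]
  field_simp
  ring

lemma norm_le_norm_hypRefl {a x : E2} (ha : 1 < ‖a‖) (hx : x ∈ unitDisk)
    (h : ‖a‖ ^ 2 - 1 ≤ ‖x - a‖ ^ 2) : ‖x‖ ≤ ‖hypRefl a x‖ := by
  have h1 := one_sub_hypRefl ha hx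
  have h2 : (‖a‖ ^ 2 - 1) / ‖x - a‖ ^ 2 ≤ 1 := by
    rwa [div_le_one (pow_pos (norm_sub_center_pos ha hx) 2)]
  have h3 := one_sub_sq_pos hx
  refine le_of_sq_le_sq ?_ (norm_nonneg _) 
  nlinarith

lemma hypRefl_side {a x : E2} (ha : 1 < ‖a‖) (hx : x ∈ unitDisk) :
    (‖a‖ ^ 2 - 1 ≤ ‖x - a‖ ^ 2 ↔ ‖hypRefl a x - a‖ ^ 2 ≤ ‖a‖ ^ 2 - 1) := by
  have hR := radius_sq_pos ha
  rw [norm_hypRefl_sub ha hx, div_le_iff₀ (pow_pos (norm_sub_center_pos ha hx) 2), sq (‖a‖ ^ 2 - 1),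
    mul_le_mul_iff_right₀ hR]

lemma hypRefl_of_eq {a x : E2} (ha : 1 < ‖a‖) (h : ‖x - a‖ ^ 2 = ‖a‖ ^ 2 - 1) :
    hypRefl a x = x := by
  rw [hypRefl_eq ha, h, div_self (radius_sq_pos ha).ne', one_smul, sub_add_cancel]

/-- Two points at different distances from the origin are exchanged by some reflection, and the
one nearer to the origin lies on the same side as the origin. -/
lemma exists_hypRefl {x y : E2} (hxy : ‖x‖ < ‖y‖) (hy : y ∈ unitDisk) :
    ∃ a : E2, 1 < ‖a‖ ∧ ‖a‖ ^ 2 - 1 < ‖x - a‖ ^ 2 ∧ hypRefl a x = y := by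
  have hx : x ∈ unitDisk := mem_unitDisk.2 (hxy.trans (mem_unitDisk.1 hy))
  have hA := one_sub_sq_pos hx
  have hB := one_sub_sq_pos hy
  set A := 1 - ‖x‖ ^ 2 with hAdef
  set B := 1 - ‖y‖ ^ 2 with hBdef
  have hAB : 0 < A - B := by
    simp only [hAdef, hBdef]; nlinarith [norm_nonneg x]
  have hD : 0 < ‖y - x‖ := by
    have : y - x ≠ 0 := by
      rw [sub_ne_zero]; rintro rfl; exact lt_irrefl _ hxy
    positivity
  let a : E2 := (A / (A - B)) • y - (B / (A - B)) • x
  have hax : x - a = -((A / (A - B)) • (y - x)) := by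
    have : (B / (A - B)) = A / (A - B) - 1 := by field_simp; ring
    simp only [a, this]
    module
  have hP : ‖x - a‖ ^ 2 = A ^ 2 / (A - B) ^ 2 * ‖y - x‖ ^ 2 := by
    rw [hax, norm_neg, norm_smul, mul_pow, Real.norm_eq_abs, sq_abs, div_pow]
  have hR : ‖a‖ ^ 2 - 1 = A * B / (A - B) ^ 2 * ‖y - x‖ ^ 2 := by
    simp only [a]
    rw [norm_sub_sq_real, norm_sub_sq_real, norm_smul, norm_smul, inner_smul_left,
      inner_smul_right, mul_pow, mul_pow, Real.norm_eq_abs, Real.norm_eq_abs, sq_abs, sq_abs]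
    have h1 : ‖x‖ ^ 2 = 1 - A := by simp [hAdef]
    have h2 : ‖y‖ ^ 2 = 1 - B := by simp [hBdef]
    rw [h1, h2]
    simp only [conj_trivial]
    field_simp
    ring
  have ha : 1 < ‖a‖ := by
    have : 0 < ‖a‖ ^ 2 - 1 := by rw [hR]; positivity
    nlinarith [norm_nonneg a]
  refine ⟨a, ha, ?_, ?_⟩
  · rw [hP, hR]
    gcongr
    nlinarith
  · rw [hypRefl_eq ha, hP, hR, hax]
    have h3 : A * B / (A - B) ^ 2 * ‖y - x‖ ^ 2 / (A ^ 2 / (A - B) ^ 2 * ‖y - x‖ ^ 2) = B / A := by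
      field_simp
    rw [h3]
    have h4 : a = x + (A / (A - B)) • (y - x) := by
      rw [← sub_eq_iff_eq_add', ← neg_sub, hax, neg_neg]
    rw [h4, smul_neg, smul_smul]
    have h5 : B / A * (A / (A - B)) = A / (A - B) - 1 := by field_simp; ring
    rw [h5]
    module

lemma measurable_hypRefl {a : E2} (ha : 1 < ‖a‖) : Measurable (hypRefl a) := by
  have : hypRefl a = fun x => ((‖a‖ ^ 2 - 1) / ‖x - a‖ ^ 2) • (x - a) + a :=
    funext (hypRefl_eq ha)
  rw [this]
  fun_prop

lemma continuousAt_hypRefl {a x : E2} (ha : 1 < ‖a‖) (hx : x ∈ unitDisk) :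
    ContinuousAt (hypRefl a) x := by
  have : x ≠ a := by
    rintro rfl
    exact absurd (mem_unitDisk.1 hx) (by linarith)
  exact (hasFDerivAt_inversion this).continuousAt

/-- The hyperbolic area measure of the Poincaré disk, up to a factor `4`. -/
def hypMeasure : Measure E2 :=
  (volume.restrict unitDisk).withDensity fun x => ENNReal.ofReal (1 / (1 - ‖x‖ ^ 2) ^ 2)

lemma measurable_hypDensity :
    Measurable fun x : E2 => ENNReal.ofReal (1 / (1 - ‖x‖ ^ 2) ^ 2) := by fun_prop

instance : SFinite hypMeasure := by unfold hypMeasure; infer_instance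

lemma ae_hypMeasure {p : E2 → Prop} (h : ∀ᵐ x ∂(volume.restrict unitDisk), p x) :
    ∀ᵐ x ∂hypMeasure, p x :=
  (withDensity_absolutelyContinuous _ _).ae_le h

lemma ae_mem_hypMeasure : ∀ᵐ x ∂hypMeasure, x ∈ unitDisk :=
  ae_hypMeasure (ae_restrict_mem measurableSet_unitDisk)

lemma abs_det_hypRefl (a x : E2) (r : ℝ) :
    |((r ^ 2 • ((ℝ ∙ (x - a))ᗮ.reflection : E2 →L[ℝ] E2)) : E2 →L[ℝ] E2).det| = r ^ 4 := by
  have h := Submodule.det_reflection (𝕜 := ℝ) (ℝ ∙ (x - a))ᗮ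
  have : ((r ^ 2 • ((ℝ ∙ (x - a))ᗮ.reflection : E2 →L[ℝ] E2)) : E2 →L[ℝ] E2).det =
      (r ^ 2) ^ 2 * LinearMap.det ((ℝ ∙ (x - a))ᗮ.reflection.toLinearMap) := by
    rw [ContinuousLinearMap.det, ContinuousLinearMap.toLinearMap_smul, LinearMap.det_smul]
    rw [finrank_euclideanSpace_fin]
    rfl
  rw [this, h, abs_mul, abs_pow (-1 : ℝ), abs_neg, abs_one, one_pow, mul_one,
    abs_of_nonneg (by positivity)]
  ring

lemma measurePreserving_hypRefl {a : E2} (ha : 1 < ‖a‖) :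
    MeasurePreserving (hypRefl a) hypMeasure hypMeasure := by
  refine ⟨measurable_hypRefl ha, ?_⟩
  ext s hs
  rw [Measure.map_apply (measurable_hypRefl ha) hs]
  have hpre : MeasurableSet (hypRefl a ⁻¹' s) := measurable_hypRefl ha hs
  rw [hypMeasure, withDensity_apply _ hs, withDensity_apply _ hpre,
    Measure.restrict_restrict hs, Measure.restrict_restrict hpre]
  have himg : s ∩ unitDisk = hypRefl a '' (hypRefl a ⁻¹' s ∩ unitDisk) := by
    ext y
    constructor
    · rintro ⟨h1, h2⟩
      exact ⟨hypRefl a y, ⟨by simpa [hypRefl_hypRefl ha] using h1, hypRefl_mem ha h2⟩,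
        hypRefl_hypRefl ha y⟩
    · rintro ⟨x, ⟨h1, h2⟩, rfl⟩
      exact ⟨h1, hypRefl_mem ha h2⟩
  have hm : MeasurableSet (hypRefl a ⁻¹' s ∩ unitDisk) := hpre.inter measurableSet_unitDisk
  rw [himg, lintegral_image_eq_lintegral_abs_det_fderiv_mul volume hm
    (f' := fun x => (√(‖a‖ ^ 2 - 1) / dist x a) ^ 2 •
      ((ℝ ∙ (x - a))ᗮ.reflection : E2 →L[ℝ] E2))]
  · refine setLIntegral_congr_fun hm fun x hx => ?_
    have hR := radius_sq_pos ha
    have hp := norm_sub_center_pos ha hx.2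
    have hA := one_sub_sq_pos hx.2
    rw [abs_det_hypRefl, ← ENNReal.ofReal_mul (by positivity), one_sub_hypRefl ha hx.2]
    congr 1
    rw [div_pow, dist_eq_norm, show (4 : ℕ) = 2 * 2 from rfl, pow_mul, pow_mul,
      Real.sq_sqrt hR.le]
    field_simp
  · intro x hx
    refine (hasFDerivAt_inversion ?_).hasFDerivWithinAt
    rintro rfl
    exact absurd (mem_unitDisk.1 hx.2) (by linarith)
  · intro x _ y _ hxy
    rw [← hypRefl_hypRefl ha x, hxy, hypRefl_hypRefl ha]

section Polarization

open Classical in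
/-- Polarization of a function on the disk, moving its larger values to the side of the origin. -/
def polarize (a : E2) (v : E2 → ℝ) (x : E2) : ℝ :=
  if x ∈ unitDisk then
    if ‖a‖ ^ 2 - 1 ≤ ‖x - a‖ ^ 2 then max (v x) (v (hypRefl a x)) else min (v x) (v (hypRefl a x))
  else 0

lemma polarize_near {a x : E2} {v : E2 → ℝ} (hx : x ∈ unitDisk)
    (h : ‖a‖ ^ 2 - 1 ≤ ‖x - a‖ ^ 2) : polarize a v x = max (v x) (v (hypRefl a x)) := by
  simp [polarize, hx, h]

lemma polarize_far {a x : E2} {v : E2 → ℝ} (ha : 1 < ‖a‖) (hx : x ∈ unitDisk)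
    (h : ‖x - a‖ ^ 2 ≤ ‖a‖ ^ 2 - 1) : polarize a v x = min (v x) (v (hypRefl a x)) := by
  rcases h.lt_or_eq with h | h
  · simp [polarize, hx, h.not_ge]
  · rw [polarize_near hx h.ge, hypRefl_of_eq ha h, max_self, min_self]

lemma polarize_hypRefl_near {a x : E2} {v : E2 → ℝ} (ha : 1 < ‖a‖) (hx : x ∈ unitDisk)
    (h : ‖a‖ ^ 2 - 1 ≤ ‖x - a‖ ^ 2) :
    polarize a v (hypRefl a x) = min (v x) (v (hypRefl a x)) := by
  rw [polarize_far ha (hypRefl_mem ha hx) ((hypRefl_side ha hx).1 h), hypRefl_hypRefl ha, min_comm]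

lemma polarize_hypRefl_far {a x : E2} {v : E2 → ℝ} (ha : 1 < ‖a‖) (hx : x ∈ unitDisk)
    (h : ‖x - a‖ ^ 2 ≤ ‖a‖ ^ 2 - 1) :
    polarize a v (hypRefl a x) = max (v x) (v (hypRefl a x)) := by
  have h' := (hypRefl_side ha (hypRefl_mem ha hx)).2 (by rwa [hypRefl_hypRefl ha])
  rw [polarize_near (hypRefl_mem ha hx) h', hypRefl_hypRefl ha, max_comm]

/-- Bounded nonnegative functions supported in the ball of radius `R` and Lipschitz for the
hyperbolic distance; the class is stable under polarization. -/
structure Admissible (R N L : ℝ) (v : E2 → ℝ) : Prop where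
  nonneg : ∀ x, 0 ≤ v x
  le : ∀ x, v x ≤ N
  supp : ∀ x, R < ‖x‖ → v x = 0
  lip : ∀ x ∈ unitDisk, ∀ y ∈ unitDisk, |v x - v y| ≤ L * √(hypSep x y)

variable {R N L : ℝ} {v : E2 → ℝ}

lemma Admissible.polarize (hv : Admissible R N L v) (hL : 0 ≤ L) {a : E2} (ha : 1 < ‖a‖) :
    Admissible R N L (polarize a v) := by
  have h0 := hv.nonneg
  refine ⟨fun x => ?_, fun x => ?_, fun x hx => ?_, fun x hx y hy => ?_⟩
  · unfold HypSymm.polarize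
    split_ifs
    · exact le_max_of_le_left (h0 x)
    · exact le_min (h0 x) (h0 _)
    · exact le_rfl
  · unfold HypSymm.polarize
    split_ifs
    · exact max_le (hv.le x) (hv.le _)
    · exact min_le_of_left_le (hv.le x)
    · exact (h0 x).trans (hv.le x)
  · by_cases hxB : x ∈ unitDisk
    · rcases le_total (‖a‖ ^ 2 - 1) (‖x - a‖ ^ 2) with h | h
      · rw [polarize_near hxB h, hv.supp x hx,
          hv.supp _ (hx.trans_le (norm_le_norm_hypRefl ha hxB h)), max_self]
      · rw [polarize_far ha hxB h, hv.supp x hx, min_eq_left (h0 _)]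
    · simp [HypSymm.polarize, hxB]
  · have hσx := hypRefl_mem ha hx
    have hσy := hypRefl_mem ha hy
    have hpos : 0 < (1 - ‖x‖ ^ 2) * (1 - ‖y‖ ^ 2) * (‖a‖ ^ 2 - 1) :=
      mul_pos (mul_pos (one_sub_sq_pos hx) (one_sub_sq_pos hy)) (radius_sq_pos ha)
    have e1 := abs_le.1 (hv.lip x hx y hy)
    have e2 := abs_le.1 (hv.lip _ hσx _ hσy)
    rw [hypSep_hypRefl ha hx hy] at e2
    have e3 := abs_le.1 (hv.lip x hx _ hσy)
    have e4 := abs_le.1 (hv.lip _ hσx y hy)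
    have hs : hypSep (hypRefl a x) y = hypSep x (hypRefl a y) := by
      rw [← hypSep_hypRefl ha hσx hy, hypRefl_hypRefl ha]
    rw [hs] at e4
    have cross : (‖x - a‖ ^ 2 - (‖a‖ ^ 2 - 1)) * (‖y - a‖ ^ 2 - (‖a‖ ^ 2 - 1)) ≤ 0 →
        L * √(hypSep x (hypRefl a y)) ≤ L * √(hypSep x y) := by
      intro h
      refine mul_le_mul_of_nonneg_left (Real.sqrt_le_sqrt ?_) hL
      rw [hypSep_hypRefl_right ha hx hy]
      have := div_nonpos_of_nonpos_of_nonneg h hpos.le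
      linarith
    rw [abs_le]
    rcases le_total (‖a‖ ^ 2 - 1) (‖x - a‖ ^ 2) with h | h <;>
      rcases le_total (‖a‖ ^ 2 - 1) (‖y - a‖ ^ 2) with h' | h'
    · rw [polarize_near hx h, polarize_near hy h']
      rcases max_cases (v x) (v (hypRefl a x)) with ⟨h1, _⟩ | ⟨h1, _⟩ <;>
      rcases max_cases (v y) (v (hypRefl a y)) with ⟨h2, _⟩ | ⟨h2, _⟩ <;>
      constructor <;> linarith
    · have := cross (mul_nonpos_of_nonneg_of_nonpos (by linarith) (by linarith))
      rw [polarize_near hx h, polarize_far ha hy h']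
      rcases max_cases (v x) (v (hypRefl a x)) with ⟨h1, _⟩ | ⟨h1, _⟩ <;>
      rcases min_cases (v y) (v (hypRefl a y)) with ⟨h2, _⟩ | ⟨h2, _⟩ <;>
      constructor <;> linarith
    · have := cross (mul_nonpos_of_nonpos_of_nonneg (by linarith) (by linarith))
      rw [polarize_far ha hx h, polarize_near hy h']
      rcases min_cases (v x) (v (hypRefl a x)) with ⟨h1, _⟩ | ⟨h1, _⟩ <;>
      rcases max_cases (v y) (v (hypRefl a y)) with ⟨h2, _⟩ | ⟨h2, _⟩ <;>
      constructor <;> linarith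
    · rw [polarize_far ha hx h, polarize_far ha hy h']
      rcases min_cases (v x) (v (hypRefl a x)) with ⟨h1, _⟩ | ⟨h1, _⟩ <;>
      rcases min_cases (v y) (v (hypRefl a y)) with ⟨h2, _⟩ | ⟨h2, _⟩ <;>
      constructor <;> linarith

lemma exists_lipschitzWith_of_admissible (hR0 : 0 ≤ R) (hR : R < 1) (hL : 0 ≤ L) (hN : 0 ≤ N) :
    ∃ C : ℝ≥0, ∀ v, Admissible R N L v → LipschitzWith C v := by
  set R' := (1 + R) / 2 with hR'
  have hR'1 : R' < 1 := by linarith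
  have hRR' : R < R' := by linarith
  have hd : 0 < 1 - R' ^ 2 := by nlinarith
  have hC1 : 0 ≤ L / (1 - R' ^ 2) := by positivity
  have hC2 : 0 ≤ N / (R' - R) := div_nonneg hN (by linarith)
  refine ⟨⟨L / (1 - R' ^ 2) + N / (R' - R), by positivity⟩, fun v hv => ?_⟩
  have far : ∀ x y : E2, ‖x‖ ≤ R → R' < ‖y‖ →
      |v x - v y| ≤ (L / (1 - R' ^ 2) + N / (R' - R)) * ‖x - y‖ := by
    intro x y hx hy
    have h1 : R' - R ≤ ‖x - y‖ := by
      have := norm_sub_norm_le y x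
      rw [norm_sub_rev] at this
      linarith
    rw [hv.supp y (hRR'.trans hy), sub_zero, abs_of_nonneg (hv.nonneg x)]
    calc v x ≤ N := hv.le x
      _ = N / (R' - R) * (R' - R) := by field_simp [(sub_pos.2 hRR').ne']
      _ ≤ N / (R' - R) * ‖x - y‖ := by gcongr
      _ ≤ _ := by gcongr; linarith
  refine LipschitzWith.of_dist_le_mul fun x y => ?_
  rw [Real.dist_eq, dist_eq_norm]
  change |v x - v y| ≤ (L / (1 - R' ^ 2) + N / (R' - R)) * ‖x - y‖
  by_cases hx : ‖x‖ ≤ R'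
  · by_cases hy : ‖y‖ ≤ R'
    · have hA : 1 - R' ^ 2 ≤ 1 - ‖x‖ ^ 2 := by gcongr
      have hB : 1 - R' ^ 2 ≤ 1 - ‖y‖ ^ 2 := by gcongr
      calc |v x - v y| ≤ L * √(hypSep x y) :=
            hv.lip x (mem_unitDisk.2 (by linarith)) y (mem_unitDisk.2 (by linarith))
        _ ≤ L * √((‖x - y‖ / (1 - R' ^ 2)) ^ 2) := by
            refine mul_le_mul_of_nonneg_left (Real.sqrt_le_sqrt ?_) hL
            rw [hypSep, div_pow, sq (1 - R' ^ 2)]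
            have := hd.trans_le hA
            gcongr
        _ = L / (1 - R' ^ 2) * ‖x - y‖ := by
            rw [Real.sqrt_sq (by positivity)]; ring
        _ ≤ _ := by gcongr; linarith
    · by_cases hx' : ‖x‖ ≤ R
      · exact far x y hx' (not_le.1 hy)
      · rw [hv.supp x (not_le.1 hx'), hv.supp y (hRR'.trans (not_le.1 hy)), sub_self, abs_zero]
        positivity
  · by_cases hy' : ‖y‖ ≤ R
    · rw [abs_sub_comm, norm_sub_rev]
      exact far y x hy' (not_le.1 hx)
    · rw [hv.supp y (not_le.1 hy'), hv.supp x (hRR'.trans (not_le.1 hx)), sub_self, abs_zero]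
      positivity

lemma Admissible.of_tendsto {f : ℕ → E2 → ℝ} (hf : ∀ n, Admissible R N L (f n))
    (h : ∀ x, Tendsto (fun n => f n x) atTop (𝓝 (v x))) : Admissible R N L v where
  nonneg x := ge_of_tendsto' (h x) fun n => (hf n).nonneg x
  le x := le_of_tendsto' (h x) fun n => (hf n).le x
  supp x hx := tendsto_nhds_unique (h x) (by simp [(hf _).supp x hx])
  lip x hx y hy := le_of_tendsto' ((h x).sub (h y)).abs fun n => (hf n).lip x hx y hy

lemma exists_subseq_of_admissible (hR0 : 0 ≤ R) (hR : R < 1) (hL : 0 ≤ L)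
    {f : ℕ → E2 → ℝ} (hf : ∀ n, Admissible R N L (f n)) :
    ∃ (v : E2 → ℝ) (φ : ℕ → ℕ), StrictMono φ ∧ Admissible R N L v ∧
      ∀ x, Tendsto (fun n => f (φ n) x) atTop (𝓝 (v x)) := by
  have hN : 0 ≤ N := ((hf 0).nonneg 0).trans ((hf 0).le 0)
  obtain ⟨C, hC⟩ := exists_lipschitzWith_of_admissible hR0 hR hL hN
  let d := TopologicalSpace.denseSeq E2
  have hK : IsCompact (Set.pi univ fun _ : ℕ => Icc (0 : ℝ) N) :=
    isCompact_univ_pi fun _ => isCompact_Icc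
  obtain ⟨g, -, φ, hφ, hg⟩ := hK.tendsto_subseq (x := fun n k => f n (d k))
    fun n k _ => ⟨(hf n).nonneg _, (hf n).le _⟩
  rw [tendsto_pi_nhds] at hg
  have hcau : ∀ x, CauchySeq fun n => f (φ n) x := by
    intro x
    rw [Metric.cauchySeq_iff]
    intro ε hε
    have hδ : 0 < ε / (4 * (C + 1)) := by positivity
    obtain ⟨k, hk⟩ := (TopologicalSpace.denseRange_denseSeq E2).exists_dist_lt x hδ
    obtain ⟨n₀, hn₀⟩ := Metric.cauchySeq_iff.1 (hg k).cauchySeq (ε / 2) (by positivity)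
    refine ⟨n₀, fun m hm n hn => ?_⟩
    have key : ∀ j, dist (f (φ j) x) (f (φ j) (d k)) ≤ ε / 4 := by
      intro j
      calc dist (f (φ j) x) (f (φ j) (d k)) ≤ C * dist x (d k) := (hC _ (hf _)).dist_le_mul _ _
        _ ≤ C * (ε / (4 * (C + 1))) := by gcongr
        _ ≤ (C + 1) * (ε / (4 * (C + 1))) := by gcongr; linarith
        _ = ε / 4 := by field_simp
    have h1 := key m
    have h2 := key n
    have h3 := hn₀ m hm n hn
    simp only [Function.comp] at h3
    rw [dist_comm] at h2
    have := dist_triangle4 (f (φ m) x) (f (φ m) (d k)) (f (φ n) (d k)) (f (φ n) x)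
    linarith
  choose v hv using fun x => cauchySeq_tendsto_of_complete (hcau x)
  exact ⟨v, φ, hφ, .of_tendsto (fun n => hf (φ n)) hv, hv⟩

end Polarization

lemma setLIntegral_unitDisk (F : E2 → ℝ≥0∞) :
    ∫⁻ x in unitDisk, F x = ∫⁻ x, ENNReal.ofReal ((1 - ‖x‖ ^ 2) ^ 2) * F x ∂hypMeasure := by
  rw [hypMeasure, lintegral_withDensity_eq_lintegral_mul_non_measurable _ measurable_hypDensity
    (Eventually.of_forall fun _ => ENNReal.ofReal_lt_top)]
  refine setLIntegral_congr_fun measurableSet_unitDisk fun x hx => ?_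
  have := one_sub_sq_pos hx
  rw [Pi.mul_apply, ← mul_assoc, ← ENNReal.ofReal_mul (by positivity)]
  have h : 1 / (1 - ‖x‖ ^ 2) ^ 2 * (1 - ‖x‖ ^ 2) ^ 2 = 1 := by field_simp
  rw [h, ENNReal.ofReal_one, one_mul]

lemma ae_hypMeasure_ne_zero : ∀ᵐ x ∂hypMeasure, x ≠ 0 :=
  ae_hypMeasure (Measure.ae_ne _ 0)

lemma ae_good_pair {a : E2} (ha : 1 < ‖a‖) :
    ∀ᵐ x ∂hypMeasure, x ∈ unitDisk ∧ x ≠ 0 ∧ hypRefl a x ≠ 0 := by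
  filter_upwards [ae_mem_hypMeasure, ae_hypMeasure_ne_zero,
    (measurePreserving_hypRefl ha).quasiMeasurePreserving.ae ae_hypMeasure_ne_zero]
    with x h1 h2 h3 using ⟨h1, h2, h3⟩

lemma add_le_max_add_min {G : ℝ → ℝ} (hG : MonotoneOn G (Ici 0)) {p q s t : ℝ} (hqp : q ≤ p)
    (hs : 0 ≤ s) (ht : 0 ≤ t) :
    p * G s + q * G t ≤ p * G (max s t) + q * G (min s t) := by
  rcases le_total s t with h | h
  · rw [max_eq_right h, min_eq_left h]
    have := hG (mem_Ici.2 hs) (mem_Ici.2 ht) h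
    nlinarith
  · rw [max_eq_left h, min_eq_right h]

section Weighted

variable {R N L : ℝ} {v : E2 → ℝ} {w : E2 → ℝ} {G : ℝ → ℝ} {a : E2}

lemma weighted_pair_le (hw0 : ∀ x, 0 ≤ w x)
    (hw : ∀ x ∈ unitDisk, ∀ y ∈ unitDisk, x ≠ 0 → ‖x‖ ≤ ‖y‖ →
      (1 - ‖y‖ ^ 2) ^ 2 * w y ≤ (1 - ‖x‖ ^ 2) ^ 2 * w x)
    (hG : MonotoneOn G (Ici 0)) (hG0 : ∀ t, 0 ≤ t → 0 ≤ G t)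
    (hv : ∀ x, 0 ≤ v x) (ha : 1 < ‖a‖) {x : E2} (hx : x ∈ unitDisk)
    (hx0 : x ≠ 0) (hσ0 : hypRefl a x ≠ 0) :
    ENNReal.ofReal ((1 - ‖x‖ ^ 2) ^ 2) * ENNReal.ofReal (w x * G (v x)) +
      ENNReal.ofReal ((1 - ‖hypRefl a x‖ ^ 2) ^ 2) *
        ENNReal.ofReal (w (hypRefl a x) * G (v (hypRefl a x))) ≤
    ENNReal.ofReal ((1 - ‖x‖ ^ 2) ^ 2) * ENNReal.ofReal (w x * G (polarize a v x)) +
      ENNReal.ofReal ((1 - ‖hypRefl a x‖ ^ 2) ^ 2) *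
        ENNReal.ofReal (w (hypRefl a x) * G (polarize a v (hypRefl a x))) := by
  have hσ := hypRefl_mem ha hx
  have hp : ∀ y, 0 ≤ w y * G (v y) := fun y => mul_nonneg (hw0 _) (hG0 _ (hv _))
  have hmax : 0 ≤ G (max (v x) (v (hypRefl a x))) := hG0 _ (le_max_of_le_left (hv _))
  have hmin : 0 ≤ G (min (v x) (v (hypRefl a x))) := hG0 _ (le_min (hv _) (hv _))
  rcases le_total (‖a‖ ^ 2 - 1) (‖x - a‖ ^ 2) with h | h
  · rw [polarize_near hx h, polarize_hypRefl_near ha hx h]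
    have := hw x hx _ hσ hx0 (norm_le_norm_hypRefl ha hx h)
    rw [← ENNReal.ofReal_mul (by positivity), ← ENNReal.ofReal_mul (by positivity),
      ← ENNReal.ofReal_mul (by positivity), ← ENNReal.ofReal_mul (by positivity),
      ← ENNReal.ofReal_add (mul_nonneg (by positivity) (hp _))
        (mul_nonneg (by positivity) (hp _)),
      ← ENNReal.ofReal_add (mul_nonneg (by positivity) (mul_nonneg (hw0 _) hmax))
        (mul_nonneg (by positivity) (mul_nonneg (hw0 _) hmin))]
    refine ENNReal.ofReal_le_ofReal ?_
    simp only [← mul_assoc]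
    exact add_le_max_add_min hG this (hv _) (hv _)
  · rw [polarize_far ha hx h, polarize_hypRefl_far ha hx h]
    have hn : ‖hypRefl a x‖ ≤ ‖x‖ := by
      have := norm_le_norm_hypRefl ha hσ
        ((hypRefl_side ha hσ).2 (by rwa [hypRefl_hypRefl ha]))
      rwa [hypRefl_hypRefl ha] at this
    have := hw _ hσ x hx hσ0 hn
    rw [← ENNReal.ofReal_mul (by positivity), ← ENNReal.ofReal_mul (by positivity),
      ← ENNReal.ofReal_mul (by positivity), ← ENNReal.ofReal_mul (by positivity),
      ← ENNReal.ofReal_add (mul_nonneg (by positivity) (hp _))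
        (mul_nonneg (by positivity) (hp _)),
      ← ENNReal.ofReal_add (mul_nonneg (by positivity) (mul_nonneg (hw0 _) hmin))
        (mul_nonneg (by positivity) (mul_nonneg (hw0 _) hmax))]
    refine ENNReal.ofReal_le_ofReal ?_
    simp only [← mul_assoc]
    rw [add_comm, add_comm (_ * _ * G (min _ _)), max_comm, min_comm]
    exact add_le_max_add_min hG this (hv _) (hv _)

lemma lintegral_add_comp_hypRefl (ha : 1 < ‖a‖) {F : E2 → ℝ≥0∞} (hF : Measurable F) :
    ∫⁻ x, (F x + F (hypRefl a x)) ∂hypMeasure = 2 * ∫⁻ x, F x ∂hypMeasure := by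
  rw [lintegral_add_left hF, (measurePreserving_hypRefl ha).lintegral_comp hF, two_mul]

/-- Polarization increases integrals of `G ∘ v` against weights which are radially decreasing
relative to the hyperbolic measure. -/
lemma lintegral_weighted_le_polarize (hw0 : ∀ x, 0 ≤ w x) (hwm : Measurable w)
    (hw : ∀ x ∈ unitDisk, ∀ y ∈ unitDisk, x ≠ 0 → ‖x‖ ≤ ‖y‖ →
      (1 - ‖y‖ ^ 2) ^ 2 * w y ≤ (1 - ‖x‖ ^ 2) ^ 2 * w x)
    (hG : MonotoneOn G (Ici 0)) (hG0 : ∀ t, 0 ≤ t → 0 ≤ G t) (hGm : Measurable G)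
    (hv : ∀ x, 0 ≤ v x) (hvm : Measurable v) (hpm : Measurable (polarize a v)) (ha : 1 < ‖a‖) :
    ∫⁻ x in unitDisk, ENNReal.ofReal (w x * G (v x)) ≤
      ∫⁻ x in unitDisk, ENNReal.ofReal (w x * G (polarize a v x)) := by
  rw [setLIntegral_unitDisk, setLIntegral_unitDisk]
  have h2 : (2 : ℝ≥0∞) ≠ 0 := by norm_num
  rw [← ENNReal.mul_le_mul_iff_right h2 ENNReal.ofNat_ne_top,
    ← lintegral_add_comp_hypRefl ha (by fun_prop), ← lintegral_add_comp_hypRefl ha (by fun_prop)]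
  refine lintegral_mono_ae ?_
  filter_upwards [ae_good_pair ha] with x ⟨hx, hx0, hσ0⟩
  exact weighted_pair_le hw0 hw hG hG0 hv ha hx hx0 hσ0

lemma absolutelyContinuous_hypMeasure : volume.restrict unitDisk ≪ hypMeasure := by
  refine withDensity_absolutelyContinuous' measurable_hypDensity.aemeasurable ?_
  filter_upwards [ae_restrict_mem measurableSet_unitDisk] with x hx
  have := one_sub_sq_pos hx
  rw [Ne, ENNReal.ofReal_eq_zero, not_le]
  positivity

/-- A function whose integral is not increased by polarization takes its larger values on the
side of the origin. -/
lemma hypRefl_le_of_lintegral_polarize_le (hv : ∀ x, 0 ≤ v x) (hvc : Continuous v)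
    (hpm : Measurable (polarize a v)) (ha : 1 < ‖a‖)
    (hfin : ∫⁻ x in unitDisk, ENNReal.ofReal (v x) ≠ ∞)
    (hle : ∫⁻ x in unitDisk, ENNReal.ofReal (polarize a v x) ≤
      ∫⁻ x in unitDisk, ENNReal.ofReal (v x))
    {x : E2} (hx : x ∈ unitDisk) (hnear : ‖a‖ ^ 2 - 1 < ‖x - a‖ ^ 2) :
    v (hypRefl a x) ≤ v x := by
  have hw : ∀ x ∈ unitDisk, ∀ y ∈ unitDisk, x ≠ 0 → ‖x‖ ≤ ‖y‖ →
      (1 - ‖y‖ ^ 2) ^ 2 * (1 : ℝ) ≤ (1 - ‖x‖ ^ 2) ^ 2 * 1 := by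
    intro x _ y hy _ hxy
    have := one_sub_sq_pos hy
    gcongr
  have hvm := hvc.measurable
  set F : (E2 → ℝ) → E2 → ℝ≥0∞ := fun u x =>
    ENNReal.ofReal ((1 - ‖x‖ ^ 2) ^ 2) * ENNReal.ofReal (1 * u x) with hF
  have hFm : ∀ u, Measurable u → Measurable (F u) := fun u hu => by
    simp only [hF]; fun_prop
  have hpt : ∀ᵐ x ∂hypMeasure, F v x + F v (hypRefl a x) ≤
      F (polarize a v) x + F (polarize a v) (hypRefl a x) := by
    filter_upwards [ae_good_pair ha] with x ⟨hx, hx0, hσ0⟩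
    exact weighted_pair_le (w := fun _ => 1) (G := id) (fun _ => zero_le_one) hw
      (monotone_id.monotoneOn _) (fun t ht => ht) hv ha hx hx0 hσ0
  have hint : ∀ u : E2 → ℝ, ∫⁻ x, F u x ∂hypMeasure = ∫⁻ x in unitDisk, ENNReal.ofReal (u x) := by
    intro u
    rw [setLIntegral_unitDisk]
    simp only [hF, one_mul]
  have heq := ae_eq_of_ae_le_of_lintegral_le hpt
    (by rw [lintegral_add_comp_hypRefl ha (hFm v hvm), hint]
        exact ENNReal.mul_ne_top (by norm_num) hfin)
    ((hFm _ hpm).add ((hFm _ hpm).comp (measurable_hypRefl ha))).aemeasurable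
    (by rw [lintegral_add_comp_hypRefl ha (hFm v hvm),
          lintegral_add_comp_hypRefl ha (hFm _ hpm), hint, hint]
        gcongr)
  set O := {x | x ∈ unitDisk ∧ ‖a‖ ^ 2 - 1 < ‖x - a‖ ^ 2 ∧ v x < v (hypRefl a x)} with hO
  have hOopen : IsOpen O := by
    rw [isOpen_iff_mem_nhds]
    rintro x ⟨h1, h2, h3⟩
    have c1 : ContinuousAt (fun x => ‖x - a‖ ^ 2) x := by fun_prop
    have c2 : ContinuousAt (fun x => v (hypRefl a x)) x :=
      ContinuousAt.comp (g := v) hvc.continuousAt (continuousAt_hypRefl ha h1)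
    filter_upwards [Metric.isOpen_ball.mem_nhds h1, c1.eventually_const_lt h2,
      hvc.continuousAt.eventually_lt c2 h3] with y e1 e2 e3 using ⟨e1, e2, e3⟩
  have hOnull : ∀ᵐ x ∂(volume.restrict unitDisk), x ∉ O := by
    refine absolutelyContinuous_hypMeasure.ae_le ?_
    filter_upwards [heq, ae_mem_hypMeasure] with x hxe hxB
    rintro ⟨-, hn, hlt⟩
    have hσ := hypRefl_mem ha hxB
    simp only [hF] at hxe
    rw [polarize_near hxB hn.le, polarize_hypRefl_near ha hxB hn.le, max_eq_right hlt.le,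
      min_eq_left hlt.le] at hxe
    have e1 := hv x
    have e2 := hv (hypRefl a x)
    rw [← ENNReal.ofReal_mul (by positivity), ← ENNReal.ofReal_mul (by positivity),
      ← ENNReal.ofReal_mul (by positivity), ← ENNReal.ofReal_mul (by positivity),
      ← ENNReal.ofReal_add (by positivity) (by positivity),
      ← ENNReal.ofReal_add (by positivity) (by positivity),
      ENNReal.ofReal_eq_ofReal_iff (by positivity) (by positivity)] at hxe
    have hA := one_sub_sq_pos hxB
    have hB := one_sub_sq_pos hσ
    have hlt2 : 1 - ‖hypRefl a x‖ ^ 2 < 1 - ‖x‖ ^ 2 := by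
      rw [one_sub_hypRefl ha hxB]
      have : (‖a‖ ^ 2 - 1) / ‖x - a‖ ^ 2 < 1 := by
        rwa [div_lt_one (pow_pos (norm_sub_center_pos ha hxB) 2)]
      nlinarith
    have hlt3 : (1 - ‖hypRefl a x‖ ^ 2) ^ 2 < (1 - ‖x‖ ^ 2) ^ 2 := by gcongr
    nlinarith
  have hOB : O ⊆ unitDisk := fun x hx => hx.1
  have h0 : volume O = 0 := by
    rw [ae_restrict_iff' measurableSet_unitDisk] at hOnull
    refine measure_mono_null ?_ hOnull
    intro x hx
    simp only [mem_compl_iff, mem_ofPred_eq, not_forall, not_not]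
    exact ⟨hOB hx, hx⟩
  have hempty := (hOopen.measure_eq_zero_iff volume).1 h0
  by_contra! hcon
  have : x ∈ O := ⟨hx, hnear, hcon⟩
  rw [hempty] at this
  exact this

end Weighted

section Nonlocal

variable {κ : ℝ → ℝ} {u v : E2 → ℝ} {a : E2}

/-- A nonlocal energy built from the hyperbolic distance. -/
def nonlocalEnergy (κ : ℝ → ℝ) (v : E2 → ℝ) : ℝ≥0∞ :=
  ∫⁻ p, ENNReal.ofReal (κ (hypSep p.1 p.2) * (v p.1 - v p.2) ^ 2)
    ∂(hypMeasure.prod hypMeasure)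

lemma measurable_hypSep : Measurable fun p : E2 × E2 => hypSep p.1 p.2 := by
  unfold hypSep
  fun_prop

lemma measurable_nonlocal (hκ : Antitone κ) (hv : Measurable v) :
    Measurable fun p : E2 × E2 =>
      ENNReal.ofReal (κ (hypSep p.1 p.2) * (v p.1 - v p.2) ^ 2) := by
  have h1 := hκ.measurable.comp measurable_hypSep
  have h2 : Measurable fun p : E2 × E2 => (v p.1 - v p.2) ^ 2 := by fun_prop
  exact (h1.mul h2).ennreal_ofReal

lemma four_point_le {k l s s' t t' : ℝ} (h : l ≤ k) :
    k * (max s s' - max t t') ^ 2 + k * (min s s' - min t t') ^ 2 +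
      (l * (max s s' - min t t') ^ 2 + l * (min s s' - max t t') ^ 2) ≤
    k * (s - t) ^ 2 + k * (s' - t') ^ 2 + (l * (s - t') ^ 2 + l * (s' - t) ^ 2) := by
  have h0 := sub_nonneg.2 h
  rcases le_total s s' with h1 | h1 <;> rcases le_total t t' with h2 | h2 <;>
    simp only [max_eq_left, max_eq_right, min_eq_left, min_eq_right, h1, h2] <;>
    nlinarith [mul_nonneg h0 (mul_nonneg (sub_nonneg.2 h1) (sub_nonneg.2 h2))]

lemma ae_prod_mem : ∀ᵐ p ∂(hypMeasure.prod hypMeasure), p.1 ∈ unitDisk ∧ p.2 ∈ unitDisk :=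
  (Measure.quasiMeasurePreserving_fst.ae ae_mem_hypMeasure).and
    (Measure.quasiMeasurePreserving_snd.ae ae_mem_hypMeasure)

lemma four_mul_nonlocalEnergy (hκ : Antitone κ) (hv : Measurable v) (ha : 1 < ‖a‖) :
    ∫⁻ p, (ENNReal.ofReal (κ (hypSep p.1 p.2) * (v p.1 - v p.2) ^ 2) +
      ENNReal.ofReal (κ (hypSep (hypRefl a p.1) (hypRefl a p.2)) *
        (v (hypRefl a p.1) - v (hypRefl a p.2)) ^ 2) +
      (ENNReal.ofReal (κ (hypSep p.1 (hypRefl a p.2)) * (v p.1 - v (hypRefl a p.2)) ^ 2) +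
      ENNReal.ofReal (κ (hypSep (hypRefl a p.1) p.2) * (v (hypRefl a p.1) - v p.2) ^ 2)))
      ∂(hypMeasure.prod hypMeasure) = 4 * nonlocalEnergy κ v := by
  have hm := measurable_nonlocal hκ hv
  have hσ := measurePreserving_hypRefl ha
  have hid := MeasurePreserving.id hypMeasure
  have h1 := (hσ.prod hσ).lintegral_comp hm
  have h2 := (hid.prod hσ).lintegral_comp hm
  have h3 := (hσ.prod hid).lintegral_comp hm
  have m1 := hm.comp (hσ.prod hσ).measurable
  have m2 := hm.comp (hid.prod hσ).measurable
  simp only [Prod.map_fst, Prod.map_snd, id] at h1 h2 h3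
  refine (lintegral_add_left (hm.add m1) _).trans ?_
  refine (congrArg₂ (· + ·) (lintegral_add_left hm _) (lintegral_add_left m2 _)).trans ?_
  simp only [Function.comp_apply, Prod.map_fst, Prod.map_snd, id]
  rw [h1, h2, h3]
  unfold nonlocalEnergy
  ring

lemma nonlocalEnergy_polarize_le (hκ : Antitone κ) (hκ0 : ∀ s, 0 ≤ κ s) (hv : Measurable v)
    (hpm : Measurable (polarize a v)) (ha : 1 < ‖a‖) :
    nonlocalEnergy κ (polarize a v) ≤ nonlocalEnergy κ v := by
  have h4 : (4 : ℝ≥0∞) ≠ 0 := by norm_num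
  rw [← ENNReal.mul_le_mul_iff_right h4 ENNReal.ofNat_ne_top,
    ← four_mul_nonlocalEnergy hκ hv ha, ← four_mul_nonlocalEnergy hκ hpm ha]
  refine lintegral_mono_ae ?_
  filter_upwards [ae_prod_mem] with p ⟨hx, hy⟩
  have hsum : ∀ r s t z w₁ w₂ w₃ w₄ : ℝ, 0 ≤ r → 0 ≤ s → 0 ≤ t → 0 ≤ z →
      ENNReal.ofReal (r * w₁ ^ 2) + ENNReal.ofReal (s * w₂ ^ 2) +
        (ENNReal.ofReal (t * w₃ ^ 2) + ENNReal.ofReal (z * w₄ ^ 2)) =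
      ENNReal.ofReal (r * w₁ ^ 2 + s * w₂ ^ 2 + (t * w₃ ^ 2 + z * w₄ ^ 2)) := by
    intros
    rw [ENNReal.ofReal_add (by positivity) (by positivity),
      ENNReal.ofReal_add (by positivity) (by positivity),
      ENNReal.ofReal_add (by positivity) (by positivity)]
  rw [hsum _ _ _ _ _ _ _ _ (hκ0 _) (hκ0 _) (hκ0 _) (hκ0 _),
    hsum _ _ _ _ _ _ _ _ (hκ0 _) (hκ0 _) (hκ0 _) (hκ0 _)]
  refine ENNReal.ofReal_le_ofReal ?_
  have hs : hypSep (hypRefl a p.1) p.2 = hypSep p.1 (hypRefl a p.2) := by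
    rw [← hypSep_hypRefl ha (hypRefl_mem ha hx) hy, hypRefl_hypRefl ha]
  rw [hypSep_hypRefl ha hx hy, hs]
  have hpos : 0 < (1 - ‖p.1‖ ^ 2) * (1 - ‖p.2‖ ^ 2) * (‖a‖ ^ 2 - 1) :=
    mul_pos (mul_pos (one_sub_sq_pos hx) (one_sub_sq_pos hy)) (radius_sq_pos ha)
  have same : 0 ≤ (‖p.1 - a‖ ^ 2 - (‖a‖ ^ 2 - 1)) * (‖p.2 - a‖ ^ 2 - (‖a‖ ^ 2 - 1)) →
      κ (hypSep p.1 (hypRefl a p.2)) ≤ κ (hypSep p.1 p.2) := by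
    intro h
    refine hκ ?_
    rw [hypSep_hypRefl_right ha hx hy]
    have := div_nonneg h hpos.le
    linarith
  have opp : (‖p.1 - a‖ ^ 2 - (‖a‖ ^ 2 - 1)) * (‖p.2 - a‖ ^ 2 - (‖a‖ ^ 2 - 1)) ≤ 0 →
      κ (hypSep p.1 p.2) ≤ κ (hypSep p.1 (hypRefl a p.2)) := by
    intro h
    refine hκ ?_
    rw [hypSep_hypRefl_right ha hx hy]
    have := div_nonpos_of_nonpos_of_nonneg h hpos.le
    linarith
  rcases le_total (‖a‖ ^ 2 - 1) (‖p.1 - a‖ ^ 2) with h | h <;>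
    rcases le_total (‖a‖ ^ 2 - 1) (‖p.2 - a‖ ^ 2) with h' | h'
  · rw [polarize_near hx h, polarize_near hy h', polarize_hypRefl_near ha hx h,
      polarize_hypRefl_near ha hy h']
    exact four_point_le (same (mul_nonneg (by linarith) (by linarith)))
  · rw [polarize_near hx h, polarize_far ha hy h', polarize_hypRefl_near ha hx h,
      polarize_hypRefl_far ha hy h']
    have := four_point_le (s := v p.1) (s' := v (hypRefl a p.1)) (t := v (hypRefl a p.2))
      (t' := v p.2) (opp (mul_nonpos_of_nonneg_of_nonpos (by linarith) (by linarith)))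
    rw [max_comm (v (hypRefl a p.2)), min_comm (v (hypRefl a p.2))] at this
    linarith
  · rw [polarize_far ha hx h, polarize_near hy h', polarize_hypRefl_far ha hx h,
      polarize_hypRefl_near ha hy h']
    have := four_point_le (s := v p.1) (s' := v (hypRefl a p.1)) (t := v (hypRefl a p.2))
      (t' := v p.2) (opp (mul_nonpos_of_nonpos_of_nonneg (by linarith) (by linarith)))
    rw [max_comm (v (hypRefl a p.2)), min_comm (v (hypRefl a p.2))] at this
    linarith
  · rw [polarize_far ha hx h, polarize_far ha hy h', polarize_hypRefl_far ha hx h,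
      polarize_hypRefl_far ha hy h']
    have := four_point_le (s := v p.1) (s' := v (hypRefl a p.1)) (t := v p.2)
      (t' := v (hypRefl a p.2)) (same (mul_nonneg_of_nonpos_of_nonpos (by linarith) (by linarith)))
    linarith

lemma nonlocalEnergy_le_of_tendsto (hκ : Antitone κ) {f : ℕ → E2 → ℝ}
    (hf : ∀ n, Measurable (f n)) (h : ∀ x, Tendsto (fun n => f n x) atTop (𝓝 (v x)))
    {c : ℝ≥0∞} (hc : ∀ n, nonlocalEnergy κ (f n) ≤ c) : nonlocalEnergy κ v ≤ c := by
  have hlim : ∀ p : E2 × E2, ENNReal.ofReal (κ (hypSep p.1 p.2) * (v p.1 - v p.2) ^ 2) =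
      liminf (fun n => ENNReal.ofReal (κ (hypSep p.1 p.2) * (f n p.1 - f n p.2) ^ 2)) atTop :=
    fun p => (ENNReal.tendsto_ofReal
      ((((h p.1).sub (h p.2)).pow 2).const_mul _)).liminf_eq.symm
  unfold nonlocalEnergy
  simp_rw [hlim]
  refine (lintegral_liminf_le fun n => measurable_nonlocal hκ (hf n)).trans ?_
  refine liminf_le_of_le ?_ fun b hb => ?_
  · isBoundedDefault
  · obtain ⟨n, hn⟩ := hb.exists
    exact hn.trans (hc n)

end Nonlocal

section Symmetrization

variable {R N L : ℝ} {w : E2 → ℝ}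

lemma tendsto_lintegral_weighted (hwm : Measurable w) {G : ℝ → ℝ}
    (hGc : Continuous G) {f : ℕ → E2 → ℝ} {v : E2 → ℝ}
    {h : E2 → ℝ≥0∞} (hh : ∫⁻ x in unitDisk, h x ≠ ∞)
    (hfm : ∀ n, Measurable (f n))
    (hfh : ∀ n, ∀ x ∈ unitDisk, ENNReal.ofReal (w x * G (f n x)) ≤ h x)
    (hlim : ∀ x, Tendsto (fun n => f n x) atTop (𝓝 (v x))) :
    Tendsto (fun n => ∫⁻ x in unitDisk, ENNReal.ofReal (w x * G (f n x))) atTop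
      (𝓝 (∫⁻ x in unitDisk, ENNReal.ofReal (w x * G (v x)))) := by
  refine tendsto_lintegral_of_dominated_convergence h (fun n => ?_) (fun n => ?_) hh ?_
  · have := hGc.measurable.comp (hfm n)
    exact (hwm.mul this).ennreal_ofReal
  · filter_upwards [ae_restrict_mem measurableSet_unitDisk] with x hx using hfh n x hx
  · exact Eventually.of_forall fun x =>
      ENNReal.tendsto_ofReal (((hGc.tendsto _).comp (hlim x)).const_mul _)

lemma volume_unitDisk_ne_top : volume unitDisk ≠ ∞ := measure_ball_lt_top.ne

lemma setLIntegral_const_unitDisk_ne_top (c : ℝ) :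
    ∫⁻ _ in unitDisk, ENNReal.ofReal c ≠ ∞ := by
  rw [setLIntegral_const]
  exact ENNReal.mul_ne_top ENNReal.ofReal_ne_top volume_unitDisk_ne_top

/-- A continuous function on the plane vanishing outside the unit disk which is not increased by
passing from a point to its mirror image away from the origin is radial. -/
lemma exists_radial_profile {v : E2 → ℝ} (hvc : Continuous v) (h0 : ∀ x ∉ unitDisk, v x = 0)
    (hmono : ∀ a x : E2, 1 < ‖a‖ → x ∈ unitDisk → ‖a‖ ^ 2 - 1 < ‖x - a‖ ^ 2 →
      v (hypRefl a x) ≤ v x) :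
    ∃ f : ℝ → ℝ, ∀ x, v x = f ‖x‖ := by
  have hlt : ∀ x y : E2, ‖x‖ < ‖y‖ → y ∈ unitDisk → v y ≤ v x := by
    intro x y hxy hy
    obtain ⟨a, ha, hn, rfl⟩ := exists_hypRefl hxy hy
    exact hmono a x ha (mem_unitDisk.2 (hxy.trans (mem_unitDisk.1 hy))) hn
  have hle : ∀ x y : E2, ‖x‖ = ‖y‖ → y ∈ unitDisk → v y ≤ v x := by
    intro x y hxy hy
    rcases eq_or_ne x 0 with rfl | hx
    · rw [norm_zero, eq_comm, norm_eq_zero] at hxy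
      rw [hxy]
    have hc : Tendsto (fun s : ℝ => v (s • x)) (𝓝[<] 1) (𝓝 (v x)) := by
      have : Continuous fun s : ℝ => v (s • x) := by fun_prop
      simpa using (this.tendsto 1).mono_left nhdsWithin_le_nhds
    refine ge_of_tendsto hc ?_
    filter_upwards [Ioo_mem_nhdsLT (zero_lt_one (α := ℝ))] with s hs
    refine hlt _ _ ?_ hy
    rw [norm_smul, Real.norm_of_nonneg hs.1.le, ← hxy]
    have : 0 < ‖x‖ := norm_pos_iff.2 hx
    nlinarith [hs.2]
  let e : E2 := EuclideanSpace.single 0 1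
  have he : ‖e‖ = 1 := by simp [e]
  refine ⟨fun r => v (r • e), fun x => ?_⟩
  have hn : ‖‖x‖ • e‖ = ‖x‖ := by rw [norm_smul, he, mul_one, norm_norm]
  by_cases hx : x ∈ unitDisk
  · have hx' : ‖x‖ • e ∈ unitDisk := by rwa [mem_unitDisk, hn, ← mem_unitDisk]
    exact le_antisymm (hle _ _ hn hx) (hle _ _ hn.symm hx')
  · have hx' : ‖x‖ • e ∉ unitDisk := by rwa [mem_unitDisk, hn, ← mem_unitDisk]
    simp only [h0 _ hx, h0 _ hx']

/-- Symmetrization by maximizing `∫ v` over a compact class stable under polarization. -/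
theorem exists_symmetrization (hR0 : 0 ≤ R) (hR : R < 1) (hL : 0 ≤ L) (hw0 : ∀ x, 0 ≤ w x)
    (hwm : Measurable w)
    (hw : ∀ x ∈ unitDisk, ∀ y ∈ unitDisk, x ≠ 0 → ‖x‖ ≤ ‖y‖ →
      (1 - ‖y‖ ^ 2) ^ 2 * w y ≤ (1 - ‖x‖ ^ 2) ^ 2 * w x)
    (hwR : ∫⁻ x in Metric.closedBall 0 R, ENNReal.ofReal (w x) ≠ ∞)
    {u : E2 → ℝ} (hu : Admissible R N L u) :
    ∃ v : E2 → ℝ, Admissible R N L v ∧ (∃ f : ℝ → ℝ, ∀ x, v x = f ‖x‖) ∧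
      ∫⁻ x in unitDisk, ENNReal.ofReal (w x * u x ^ 2) ≤
        ∫⁻ x in unitDisk, ENNReal.ofReal (w x * v x ^ 2) ∧
      ∫⁻ x in unitDisk, ENNReal.ofReal (1 * rexp (4 * π * u x ^ 2)) ≤
        ∫⁻ x in unitDisk, ENNReal.ofReal (1 * rexp (4 * π * v x ^ 2)) ∧
      ∀ κ : ℝ → ℝ, Antitone κ → (∀ s, 0 ≤ κ s) → nonlocalEnergy κ v ≤ nonlocalEnergy κ u := by
  have hN : 0 ≤ N := (hu.nonneg 0).trans (hu.le 0)
  obtain ⟨C, hC⟩ := exists_lipschitzWith_of_admissible hR0 hR hL hN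
  have hmeas : ∀ v, Admissible R N L v → Measurable v := fun v hv =>
    (hC v hv).continuous.measurable
  have hsqm : MonotoneOn (fun t : ℝ => t ^ 2) (Ici 0) := fun s hs t _ hst => by
    have : (0 : ℝ) ≤ s := hs
    simp only
    gcongr
  have hexpm : MonotoneOn (fun t : ℝ => rexp (4 * π * t ^ 2)) (Ici 0) := fun s hs t _ hst => by
    have : (0 : ℝ) ≤ s := hs
    simp only
    gcongr
  have hw1 : ∀ x ∈ unitDisk, ∀ y ∈ unitDisk, x ≠ 0 → ‖x‖ ≤ ‖y‖ →
      (1 - ‖y‖ ^ 2) ^ 2 * (1 : ℝ) ≤ (1 - ‖x‖ ^ 2) ^ 2 * 1 := by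
    intro x _ y hy _ hxy
    have := one_sub_sq_pos hy
    gcongr
  let S : Set (E2 → ℝ) := {v | Admissible R N L v ∧
      ∫⁻ x in unitDisk, ENNReal.ofReal (w x * u x ^ 2) ≤
        ∫⁻ x in unitDisk, ENNReal.ofReal (w x * v x ^ 2) ∧
      ∫⁻ x in unitDisk, ENNReal.ofReal (1 * rexp (4 * π * u x ^ 2)) ≤
        ∫⁻ x in unitDisk, ENNReal.ofReal (1 * rexp (4 * π * v x ^ 2)) ∧
      ∀ κ : ℝ → ℝ, Antitone κ → (∀ s, 0 ≤ κ s) → nonlocalEnergy κ v ≤ nonlocalEnergy κ u}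
  let J : (E2 → ℝ) → ℝ≥0∞ := fun v => ∫⁻ x in unitDisk, ENNReal.ofReal (1 * v x)
  have huS : u ∈ S := ⟨hu, le_rfl, le_rfl, fun _ _ _ => le_rfl⟩
  obtain ⟨c, -, hc, hcS⟩ := exists_seq_tendsto_sSup (S := J '' S) ⟨_, u, huS, rfl⟩
    (OrderTop.bddAbove _)
  choose f hfS hfJ using hcS
  obtain ⟨v, φ, hφ, hv, hlim⟩ := exists_subseq_of_admissible hR0 hR hL fun n => (hfS n).1
  have hfφ : ∀ n, Admissible R N L (f (φ n)) := fun n => (hfS (φ n)).1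
  have hvS : v ∈ S := by
    refine ⟨hv, ?_, ?_, fun κ hκ hκ0 => ?_⟩
    · refine ge_of_tendsto' (tendsto_lintegral_weighted hwm (G := fun t => t ^ 2)
        (by fun_prop) (f := fun n => f (φ n))
        (h := (Metric.closedBall 0 R).indicator fun x =>
          ENNReal.ofReal (N ^ 2) * ENNReal.ofReal (w x)) ?_
        (fun n => hmeas _ (hfφ n)) (fun n x _ => ?_) hlim) fun n => (hfS (φ n)).2.1
      · refine ne_top_of_le_ne_top ?_ (setLIntegral_le_lintegral _ _)
        rw [lintegral_indicator Metric.isClosed_closedBall.measurableSet,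
          lintegral_const_mul _ hwm.ennreal_ofReal]
        exact ENNReal.mul_ne_top ENNReal.ofReal_ne_top hwR
      · by_cases hx : x ∈ Metric.closedBall (0 : E2) R
        · rw [indicator_of_mem hx, ← ENNReal.ofReal_mul (by positivity), mul_comm]
          refine ENNReal.ofReal_le_ofReal ?_
          have h1 := (hfφ n).nonneg x
          have h2 := (hfφ n).le x
          have h3 := hw0 x
          gcongr
        · rw [(hfφ n).supp x (by simpa using hx)]
          simp
    · refine ge_of_tendsto' (tendsto_lintegral_weighted (w := fun _ => 1) measurable_const
        (G := fun t => rexp (4 * π * t ^ 2))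
        (by fun_prop) (f := fun n => f (φ n))
        (setLIntegral_const_unitDisk_ne_top (rexp (4 * π * N ^ 2)))
        (fun n => hmeas _ (hfφ n)) (fun n x _ => ?_) hlim) fun n => (hfS (φ n)).2.2.1
      rw [one_mul]
      refine ENNReal.ofReal_le_ofReal ?_
      exact hexpm (mem_Ici.2 ((hfφ n).nonneg x)) (mem_Ici.2 hN) ((hfφ n).le x)
    · exact nonlocalEnergy_le_of_tendsto hκ (fun n => hmeas _ (hfφ n)) hlim
        fun n => (hfS (φ n)).2.2.2 κ hκ hκ0
  have hJv : J v = sSup (J '' S) := by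
    refine tendsto_nhds_unique ?_ (hc.comp hφ.tendsto_atTop)
    have := tendsto_lintegral_weighted (w := fun _ => 1) measurable_const
        (G := fun t => t)
        (by fun_prop) (f := fun n => f (φ n))
        (setLIntegral_const_unitDisk_ne_top N)
        (fun n => hmeas _ (hfφ n)) (fun n x _ => ?_) hlim
    · simpa only [Function.comp_def, ← hfJ] using this
    · rw [one_mul]
      exact ENNReal.ofReal_le_ofReal ((hfφ n).le x)
  refine ⟨v, hv, ?_, hvS.2⟩
  refine exists_radial_profile (hC v hv).continuous
    (fun x hx => hv.supp x (hR.trans_le (not_lt.1 (mt mem_unitDisk.2 hx)))) fun a x ha hx hn => ?_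
  have hpv := hv.polarize hL ha
  have hpm := hmeas _ hpv
  have hpS : polarize a v ∈ S := by
    refine ⟨hpv, hvS.2.1.trans ?_, hvS.2.2.1.trans ?_, fun κ hκ hκ0 =>
      (nonlocalEnergy_polarize_le hκ hκ0 (hmeas _ hv) hpm ha).trans (hvS.2.2.2 κ hκ hκ0)⟩
    · exact lintegral_weighted_le_polarize hw0 hwm hw hsqm (fun t _ => by positivity)
        (by fun_prop) hv.nonneg (hmeas _ hv) hpm ha
    · exact lintegral_weighted_le_polarize (w := fun _ => 1) (fun _ => zero_le_one)
        measurable_const hw1 hexpm (fun t _ => by positivity)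
        (by fun_prop) hv.nonneg (hmeas _ hv) hpm ha
  have hJle : J (polarize a v) ≤ J v := hJv ▸ le_sSup ⟨_, hpS, rfl⟩
  simp only [J, one_mul] at hJle
  refine hypRefl_le_of_lintegral_polarize_le hv.nonneg (hC v hv).continuous hpm ha ?_ hJle hx hn
  exact ne_top_of_le_ne_top (setLIntegral_const_unitDisk_ne_top N)
    (lintegral_mono fun x => ENNReal.ofReal_le_ofReal (hv.le x))

end Symmetrization

section LocalLimit

variable {t : ℝ} {u v : E2 → ℝ} {x z : E2} {C : ℝ≥0}

/-- The integrand of the rescaled nonlocal energy at `x`, after the substitution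
`y = x + t (1 - ‖x‖²) z`. -/
def scaledDiff (v : E2 → ℝ) (t : ℝ) (x z : E2) : ℝ≥0∞ :=
  if ‖z‖ ^ 2 * (1 - ‖x‖ ^ 2) < 1 - ‖x + (t * (1 - ‖x‖ ^ 2)) • z‖ ^ 2 then
    ENNReal.ofReal (((v (x + (t * (1 - ‖x‖ ^ 2)) • z) - v x) / t) ^ 2 /
      (1 - ‖x + (t * (1 - ‖x‖ ^ 2)) • z‖ ^ 2) ^ 2)
  else 0

lemma lintegral_hypMeasure (F : E2 → ℝ≥0∞) :
    ∫⁻ x, F x ∂hypMeasure =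
      ∫⁻ x in unitDisk, ENNReal.ofReal (1 / (1 - ‖x‖ ^ 2) ^ 2) * F x := by
  rw [hypMeasure, lintegral_withDensity_eq_lintegral_mul_non_measurable _ measurable_hypDensity
    (Eventually.of_forall fun _ => ENNReal.ofReal_lt_top)]
  rfl

lemma lintegral_eq_scale (x : E2) {r : ℝ} (hr : 0 < r) (f : E2 → ℝ≥0∞) :
    ∫⁻ y, f y = ENNReal.ofReal (r ^ 2) * ∫⁻ z, f (x + r • z) := by
  have h := lintegral_map_equiv (μ := (volume : Measure E2)) (fun y => f (x + y))
    (Homeomorph.smul (Units.mk0 r hr.ne')).toMeasurableEquiv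
  have h2 : Measure.map (⇑(Homeomorph.smul (Units.mk0 r hr.ne')).toMeasurableEquiv)
      (volume : Measure E2) = ENNReal.ofReal |(r ^ 2)⁻¹| • volume := by
    have := Measure.map_addHaar_smul (volume : Measure E2) hr.ne'
    have hfun : ⇑(Homeomorph.smul (Units.mk0 r hr.ne')).toMeasurableEquiv =
      fun x : E2 => r • x := rfl
    rw [hfun]
    simpa using this
  rw [h2, lintegral_smul_measure, lintegral_add_left_eq_self f x, smul_eq_mul] at h
  have h3 : ∫⁻ z, f (x + r • z) = ENNReal.ofReal |(r ^ 2)⁻¹| * ∫⁻ y, f y := h.symm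
  rw [h3, ← mul_assoc, ← ENNReal.ofReal_mul (by positivity), abs_of_pos (by positivity),
    mul_inv_cancel₀ (by positivity), ENNReal.ofReal_one, one_mul]

/-- The indicator function of `s < t²`. -/
def cutoffKernel (t s : ℝ) : ℝ := if s < t ^ 2 then 1 else 0

lemma cutoffKernel_nonneg (t s : ℝ) : 0 ≤ cutoffKernel t s := by
  unfold cutoffKernel; split_ifs <;> norm_num

lemma antitone_cutoffKernel (t : ℝ) : Antitone (cutoffKernel t) := by
  intro a b h
  unfold cutoffKernel
  split_ifs with h1 h2
  · exact le_rfl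
  · exact absurd (h.trans_lt h1) h2
  · exact zero_le_one
  · exact le_rfl

lemma nonlocalEnergy_cutoffKernel (hv : Measurable v) (ht : 0 < t) :
    nonlocalEnergy (cutoffKernel t) v =
      ENNReal.ofReal (t ^ 4) * ∫⁻ x in unitDisk, ∫⁻ z, scaledDiff v t x z := by
  have hm := measurable_nonlocal (antitone_cutoffKernel t) hv
  rw [nonlocalEnergy, lintegral_prod _ hm.aemeasurable, lintegral_hypMeasure,
    ← lintegral_const_mul' _ _ ENNReal.ofReal_ne_top]
  refine setLIntegral_congr_fun measurableSet_unitDisk fun x hx => ?_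
  have hA := one_sub_sq_pos hx
  simp only
  rw [lintegral_hypMeasure, ← lintegral_indicator measurableSet_unitDisk,
    lintegral_eq_scale x (mul_pos ht hA), ← lintegral_const_mul' _ _ ENNReal.ofReal_ne_top,
    ← lintegral_const_mul' _ _ ENNReal.ofReal_ne_top,
    ← lintegral_const_mul' _ _ ENNReal.ofReal_ne_top]
  refine lintegral_congr fun z => ?_
  set y := x + (t * (1 - ‖x‖ ^ 2)) • z with hy
  by_cases hyB : y ∈ unitDisk
  · have hAy := one_sub_sq_pos hyB
    rw [indicator_of_mem hyB]
    have hsep : hypSep x y < t ^ 2 ↔ ‖z‖ ^ 2 * (1 - ‖x‖ ^ 2) < 1 - ‖y‖ ^ 2 := by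
      have e : ‖x - y‖ ^ 2 = t ^ 2 * (1 - ‖x‖ ^ 2) ^ 2 * ‖z‖ ^ 2 := by
        rw [hy, sub_add_cancel_left, norm_neg, norm_smul, Real.norm_eq_abs,
          abs_of_pos (mul_pos ht hA)]
        ring
      rw [hypSep, e, div_lt_iff₀ (mul_pos hA hAy)]
      have e2 : t ^ 2 * (1 - ‖x‖ ^ 2) ^ 2 * ‖z‖ ^ 2 =
        (t ^ 2 * (1 - ‖x‖ ^ 2)) * (‖z‖ ^ 2 * (1 - ‖x‖ ^ 2)) := by ring
      have e3 : t ^ 2 * ((1 - ‖x‖ ^ 2) * (1 - ‖y‖ ^ 2)) =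
        (t ^ 2 * (1 - ‖x‖ ^ 2)) * (1 - ‖y‖ ^ 2) := by ring
      rw [e2, e3]
      exact mul_lt_mul_iff_right₀ (by positivity)
    rw [scaledDiff, cutoffKernel, ← hy]
    by_cases h : hypSep x y < t ^ 2
    · rw [if_pos h, if_pos (hsep.1 h), ← ENNReal.ofReal_mul (by positivity),
        ← ENNReal.ofReal_mul (by positivity), ← ENNReal.ofReal_mul (by positivity),
        ← ENNReal.ofReal_mul (by positivity)]
      congr 1
      field_simp
      ring
    · rw [if_neg h, if_neg (fun h' => h (hsep.2 h'))]
      simp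
  · rw [indicator_of_notMem hyB, scaledDiff, if_neg]
    · simp
    · rw [← hy]
      have h1 : 1 ≤ ‖y‖ := not_lt.1 (fun h => hyB (mem_unitDisk.2 h))
      have : 0 ≤ ‖z‖ ^ 2 * (1 - ‖x‖ ^ 2) := by positivity
      nlinarith

lemma measurable_scaledDiff (hv : Measurable v) :
    Measurable fun p : E2 × E2 => scaledDiff v t p.1 p.2 := by
  unfold scaledDiff
  refine Measurable.ite (measurableSet_lt (by fun_prop) (by fun_prop)) ?_ measurable_const
  fun_prop

lemma scaledDiff_le (hv : LipschitzWith C v) (ht : 0 < t) (ht3 : t ≤ 1 / 3)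
    (hx : x ∈ unitDisk) :
    scaledDiff v t x z ≤
      (Metric.ball (0 : E2) 2).indicator (fun _ => ENNReal.ofReal (16 * C ^ 2)) z := by
  unfold scaledDiff
  split_ifs with h
  swap
  · exact zero_le
  have hA := one_sub_sq_pos hx
  set y := x + (t * (1 - ‖x‖ ^ 2)) • z with hy
  have hAy : 0 < 1 - ‖y‖ ^ 2 := lt_of_le_of_lt (by positivity) h
  have hx1 := mem_unitDisk.1 hx
  have hy1 : ‖y‖ < 1 := by nlinarith [norm_nonneg y]
  have hyx : ‖y - x‖ = t * (1 - ‖x‖ ^ 2) * ‖z‖ := by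
    rw [hy, add_sub_cancel_left, norm_smul, Real.norm_eq_abs, abs_of_pos (mul_pos ht hA)]
  have hd : |‖y‖ - ‖x‖| ≤ ‖y - x‖ := abs_norm_sub_norm_le _ _
  have hz0 := norm_nonneg z
  have hAM : ‖z‖ * (1 - ‖x‖ ^ 2) ≤ ((1 - ‖x‖ ^ 2) + (1 - ‖y‖ ^ 2)) / 2 := by
    refine abs_le_of_sq_le_sq' ?_ (by linarith) |>.2
    nlinarith [sq_nonneg ((1 - ‖x‖ ^ 2) - (1 - ‖y‖ ^ 2))]
  have hdiff : |(1 - ‖x‖ ^ 2) - (1 - ‖y‖ ^ 2)| ≤ t * ((1 - ‖x‖ ^ 2) + (1 - ‖y‖ ^ 2)) := by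
    have e : (1 - ‖x‖ ^ 2) - (1 - ‖y‖ ^ 2) = (‖y‖ - ‖x‖) * (‖y‖ + ‖x‖) := by ring
    rw [e, abs_mul, abs_of_nonneg (by positivity : 0 ≤ ‖y‖ + ‖x‖)]
    calc |‖y‖ - ‖x‖| * (‖y‖ + ‖x‖) ≤ ‖y - x‖ * 2 := by gcongr; linarith
      _ = t * (2 * (‖z‖ * (1 - ‖x‖ ^ 2))) := by rw [hyx]; ring
      _ ≤ _ := by gcongr; linarith
  have hdiff' : |(1 - ‖x‖ ^ 2) - (1 - ‖y‖ ^ 2)| ≤ 1 / 3 * ((1 - ‖x‖ ^ 2) + (1 - ‖y‖ ^ 2)) :=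
    hdiff.trans (by gcongr)
  obtain ⟨d1, d2⟩ := abs_le.1 hdiff'
  have hA2 : 1 - ‖x‖ ^ 2 ≤ 2 * (1 - ‖y‖ ^ 2) := by linarith
  have hA3 : 1 - ‖y‖ ^ 2 ≤ 2 * (1 - ‖x‖ ^ 2) := by linarith
  have hz2 : ‖z‖ ^ 2 < 2 := by
    by_contra! hcon
    nlinarith
  have hz : ‖z‖ < 2 := by nlinarith
  rw [indicator_of_mem (by simpa using hz)]
  refine ENNReal.ofReal_le_ofReal ?_
  have hl : |v y - v x| ≤ C * (t * (1 - ‖x‖ ^ 2) * ‖z‖) := by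
    have := hv.dist_le_mul y x
    rwa [Real.dist_eq, dist_eq_norm, hyx] at this
  rw [div_le_iff₀ (by positivity), div_pow, div_le_iff₀ (by positivity), ← sq_abs (v y - v x)]
  calc |v y - v x| ^ 2 ≤ (C * (t * (1 - ‖x‖ ^ 2) * ‖z‖)) ^ 2 := by gcongr
    _ = C ^ 2 * t ^ 2 * (‖z‖ ^ 2 * (1 - ‖x‖ ^ 2) ^ 2) := by ring
    _ ≤ C ^ 2 * t ^ 2 * (2 * (2 * (1 - ‖y‖ ^ 2)) ^ 2) := by gcongr
    _ ≤ _ := by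
      have : (0:ℝ) ≤ C ^ 2 * t ^ 2 * (1 - ‖y‖ ^ 2) ^ 2 := by positivity
      nlinarith

lemma tendsto_scaledDiff (hx : x ∈ unitDisk) (hd : DifferentiableAt ℝ v x) (hz : ‖z‖ ≠ 1)
    {s : ℕ → ℝ} (hs : Tendsto s atTop (𝓝[>] 0)) :
    Tendsto (fun n => scaledDiff v (s n) x z) atTop
      (𝓝 ((Metric.ball (0 : E2) 1).indicator
        (fun z => ENNReal.ofReal ((fderiv ℝ v x z) ^ 2)) z)) := by
  have hA := one_sub_sq_pos hx
  have hs0 : Tendsto s atTop (𝓝 0) := hs.mono_right nhdsWithin_le_nhds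
  have hy : Tendsto (fun n => x + (s n * (1 - ‖x‖ ^ 2)) • z) atTop (𝓝 x) := by
    have : Tendsto (fun n => x + (s n * (1 - ‖x‖ ^ 2)) • z) atTop
        (𝓝 (x + (0 * (1 - ‖x‖ ^ 2)) • z)) :=
      ((hs0.mul_const _).smul_const z).const_add x
    simpa using this
  have hAy : Tendsto (fun n => 1 - ‖x + (s n * (1 - ‖x‖ ^ 2)) • z‖ ^ 2) atTop
      (𝓝 (1 - ‖x‖ ^ 2)) := (hy.norm.pow 2).const_sub 1
  rcases lt_or_gt_of_ne hz with h | h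
  · rw [indicator_of_mem (by simpa using h)]
    have hlt : ‖z‖ ^ 2 * (1 - ‖x‖ ^ 2) < 1 - ‖x‖ ^ 2 := by
      have : ‖z‖ ^ 2 < 1 := by nlinarith [norm_nonneg z]
      nlinarith
    have hq : Tendsto (fun n => (v (x + (s n * (1 - ‖x‖ ^ 2)) • z) - v x) / s n) atTop
        (𝓝 ((1 - ‖x‖ ^ 2) * fderiv ℝ v x z)) := by
      have h1 := (hd.hasFDerivAt.hasLineDerivAt ((1 - ‖x‖ ^ 2) • z)).tendsto_slope_zero_right
      have h2 := h1.comp hs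
      rw [map_smul, smul_eq_mul] at h2
      refine h2.congr fun n => ?_
      simp [smul_smul, div_eq_inv_mul]
    have hlim : Tendsto (fun n => ENNReal.ofReal
        (((v (x + (s n * (1 - ‖x‖ ^ 2)) • z) - v x) / s n) ^ 2 /
          (1 - ‖x + (s n * (1 - ‖x‖ ^ 2)) • z‖ ^ 2) ^ 2)) atTop
        (𝓝 (ENNReal.ofReal ((fderiv ℝ v x z) ^ 2))) := by
      have h3 := ENNReal.tendsto_ofReal ((hq.pow 2).div (hAy.pow 2) (by positivity))
      have h4 : ((1 - ‖x‖ ^ 2) * fderiv ℝ v x z) ^ 2 / (1 - ‖x‖ ^ 2) ^ 2 =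
        (fderiv ℝ v x z) ^ 2 := by field_simp
      rwa [h4] at h3
    refine hlim.congr' ?_
    filter_upwards [hAy.eventually_const_lt hlt] with n hn
    rw [scaledDiff, if_pos hn]
  · rw [indicator_of_notMem (by simpa using h.le)]
    have hlt : 1 - ‖x‖ ^ 2 < ‖z‖ ^ 2 * (1 - ‖x‖ ^ 2) := by
      have : 1 < ‖z‖ ^ 2 := by nlinarith [norm_nonneg z]
      nlinarith
    refine tendsto_const_nhds.congr' ?_
    filter_upwards [hAy.eventually_lt_const hlt] with n hn
    rw [scaledDiff, if_neg hn.not_gt]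

/-- The second moment of a coordinate over the unit disk. -/
def secondMoment : ℝ≥0∞ :=
  ∫⁻ z in Metric.ball (0 : E2) 1, ENNReal.ofReal ((z 0) ^ 2)

lemma lintegral_sq_eq (l : E2 →L[ℝ] ℝ) :
    ∫⁻ z in Metric.ball (0 : E2) 1, ENNReal.ofReal ((l z) ^ 2) =
      ENNReal.ofReal (‖l‖ ^ 2) * secondMoment := by
  obtain ⟨a, rfl⟩ := (InnerProductSpace.toDual ℝ E2).surjective l
  set e : E2 := ‖a‖ • EuclideanSpace.single 0 1 with he
  have hn : ‖a‖ = ‖e‖ := by rw [he, norm_smul]; simp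
  set ρ := (ℝ ∙ (a - e))ᗮ.reflection with hρ
  have hρa : ρ a = e := Submodule.reflection_sub hn
  have hmp := ρ.measurePreserving
  have hinner : ∀ z, inner ℝ a z = ‖a‖ * (ρ z) 0 := by
    intro z
    rw [← ρ.inner_map_map a z, hρa, he, inner_smul_left]
    simp [EuclideanSpace.inner_single_left]
  have hpre : ρ ⁻¹' Metric.ball (0 : E2) 1 = Metric.ball 0 1 := by
    ext z; simp
  have key := hmp.setLIntegral_comp_preimage_emb (f := fun z : E2 => ENNReal.ofReal ((z 0) ^ 2))
    ρ.toHomeomorph.measurableEmbedding (Metric.ball (0 : E2) 1)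
  rw [hpre] at key
  rw [secondMoment, ← key, ← lintegral_const_mul' _ _ ENNReal.ofReal_ne_top]
  refine lintegral_congr fun z => ?_
  rw [← ENNReal.ofReal_mul (by positivity)]
  simp only [InnerProductSpace.toDual_apply_apply, LinearIsometryEquiv.norm_map]
  rw [hinner z, mul_pow]

lemma secondMoment_ne_top : secondMoment ≠ ∞ := by
  refine ((setLIntegral_mono' (g := fun _ => 1) Metric.isOpen_ball.measurableSet
    fun z hz => ?_).trans_lt ?_).ne
  · refine ENNReal.ofReal_le_one.2 ?_
    have h1 := PiLp.norm_apply_le z 0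
    have h2 : ‖z‖ < 1 := by simpa using hz
    rw [← sq_abs, ← Real.norm_eq_abs]
    nlinarith [norm_nonneg (z 0)]
  · rw [setLIntegral_one]
    exact measure_ball_lt_top

lemma secondMoment_ne_zero : secondMoment ≠ 0 := by
  intro h
  rw [secondMoment, lintegral_eq_zero_iff (by fun_prop)] at h
  have hO : IsOpen (Metric.ball (0 : E2) 1 ∩ {z : E2 | z 0 ≠ 0}) :=
    Metric.isOpen_ball.inter (isOpen_ne_fun (by fun_prop) continuous_const)
  have hne : (Metric.ball (0 : E2) 1 ∩ {z : E2 | z 0 ≠ 0}).Nonempty := by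
    refine ⟨EuclideanSpace.single 0 (2⁻¹ : ℝ), ?_, ?_⟩
    · rw [mem_ball_zero_iff, EuclideanSpace.single, PiLp.norm_single]
      norm_num
    · simp
  refine (hO.measure_pos volume hne).ne' ?_
  have h2 := (ae_restrict_iff' (μ := volume) Metric.isOpen_ball.measurableSet).1 h
  refine measure_mono_null ?_ h2
  rintro z ⟨hz, hz0⟩ hcon
  have h3 := hcon hz
  simp only [Pi.zero_apply, ENNReal.ofReal_eq_zero] at h3
  exact hz0 (pow_eq_zero_iff two_ne_zero |>.1 (le_antisymm h3 (sq_nonneg _)))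

lemma tendsto_nonlocalEnergy (hv : LipschitzWith C v) :
    Tendsto (fun n : ℕ => ∫⁻ x in unitDisk, ∫⁻ z, scaledDiff v (1 / ((n : ℝ) + 3)) x z) atTop
      (𝓝 ((∫⁻ x in unitDisk, ENNReal.ofReal (‖fderiv ℝ v x‖ ^ 2)) * secondMoment)) := by
  have hvm := hv.continuous.measurable
  have hpos : ∀ n : ℕ, 0 < 1 / ((n : ℝ) + 3) := fun n => by positivity
  have hle : ∀ n : ℕ, 1 / ((n : ℝ) + 3) ≤ 1 / 3 := fun n =>
    one_div_le_one_div_of_le (by norm_num) (by linarith [n.cast_nonneg (α := ℝ)])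
  have hs : Tendsto (fun n : ℕ => 1 / ((n : ℝ) + 3)) atTop (𝓝[>] 0) := by
    refine tendsto_nhdsWithin_iff.2 ⟨?_, Eventually.of_forall hpos⟩
    simp_rw [one_div]
    exact tendsto_inv_atTop_zero.comp
      (tendsto_atTop_add_const_right _ _ tendsto_natCast_atTop_atTop)
  have hbd : (∫⁻ z, (Metric.ball (0 : E2) 2).indicator
      (fun _ => ENNReal.ofReal (16 * (C : ℝ) ^ 2)) z) ≠ ∞ := by
    rw [lintegral_indicator Metric.isOpen_ball.measurableSet, setLIntegral_const]
    exact ENNReal.mul_ne_top ENNReal.ofReal_ne_top measure_ball_lt_top.ne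
  rw [← lintegral_mul_const' _ _ secondMoment_ne_top]
  refine tendsto_lintegral_of_dominated_convergence
    (fun _ => ∫⁻ z, (Metric.ball (0 : E2) 2).indicator
      (fun _ => ENNReal.ofReal (16 * (C : ℝ) ^ 2)) z)
    (fun n => (measurable_scaledDiff hvm).lintegral_prod_right) (fun n => ?_) ?_ ?_
  · filter_upwards [ae_restrict_mem measurableSet_unitDisk] with x hx
    exact lintegral_mono fun z => scaledDiff_le hv (hpos n) (hle n) hx
  · rw [setLIntegral_const]
    exact ENNReal.mul_ne_top hbd volume_unitDisk_ne_top
  · filter_upwards [ae_restrict_mem measurableSet_unitDisk,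
      ae_restrict_of_ae hv.ae_differentiableAt] with x hx hd
    rw [← lintegral_sq_eq, ← lintegral_indicator Metric.isOpen_ball.measurableSet]
    refine tendsto_lintegral_of_dominated_convergence _
      (fun n => (measurable_scaledDiff hvm).of_uncurry_left)
      (fun n => Eventually.of_forall fun z => scaledDiff_le hv (hpos n) (hle n) hx) hbd ?_
    have hsph : ∀ᵐ z : E2, z ∉ Metric.sphere (0 : E2) 1 :=
      measure_eq_zero_iff_ae_notMem.1 (Measure.addHaar_sphere _ _ _)
    filter_upwards [hsph] with z hz
    exact tendsto_scaledDiff hx hd (by simpa using hz) hs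

/-- Monotonicity of all nonlocal energies implies monotonicity of the Dirichlet energy. -/
theorem dirichlet_le_of_nonlocalEnergy_le {C' : ℝ≥0} (hv : LipschitzWith C v)
    (hu : LipschitzWith C' u)
    (h : ∀ κ : ℝ → ℝ, Antitone κ → (∀ s, 0 ≤ κ s) → nonlocalEnergy κ v ≤ nonlocalEnergy κ u) :
    ∫⁻ x in unitDisk, ENNReal.ofReal (‖fderiv ℝ v x‖ ^ 2) ≤
      ∫⁻ x in unitDisk, ENNReal.ofReal (‖fderiv ℝ u x‖ ^ 2) := by
  refine (ENNReal.mul_le_mul_iff_left secondMoment_ne_zero secondMoment_ne_top).1 ?_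
  refine le_of_tendsto_of_tendsto' (tendsto_nonlocalEnergy hv) (tendsto_nonlocalEnergy hu)
    fun n => ?_
  have hpos : 0 < 1 / ((n : ℝ) + 3) := by positivity
  have h1 := h _ (antitone_cutoffKernel (1 / ((n : ℝ) + 3))) (cutoffKernel_nonneg _)
  rw [nonlocalEnergy_cutoffKernel hv.continuous.measurable hpos,
    nonlocalEnergy_cutoffKernel hu.continuous.measurable hpos] at h1
  exact (ENNReal.mul_le_mul_iff_right
    (ENNReal.ofReal_pos.2 (by positivity)).ne' ENNReal.ofReal_ne_top).1 h1

end LocalLimit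

section Mollification

variable {u v : E2 → ℝ} {x z : E2} {C : ℝ≥0} {R ε : ℝ}

lemma exists_profile_of_comp_isometry {w : E2 → ℝ} (h : ∀ (ρ : E2 ≃ₗᵢ[ℝ] E2) x, w (ρ x) = w x) :
    ∃ f : ℝ → ℝ, ∀ x, w x = f ‖x‖ := by
  refine ⟨fun r => w (r • EuclideanSpace.single 0 1), fun x => ?_⟩
  have hn : ‖x‖ = ‖‖x‖ • (EuclideanSpace.single 0 1 : E2)‖ := by rw [norm_smul]; simp
  have := h (ℝ ∙ (x - ‖x‖ • (EuclideanSpace.single 0 1 : E2)))ᗮ.reflection x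
  rw [Submodule.reflection_sub hn] at this
  exact this.symm

lemma contDiff_smoothTransition_normSq (a b : ℝ) :
    ContDiff ℝ (⊤ : ℕ∞) fun x : E2 => Real.smoothTransition (a + b * ‖x‖ ^ 2) :=
  Real.smoothTransition.contDiff.comp
    (contDiff_const.add (contDiff_const.mul (contDiff_norm_sq ℝ)))

/-- Radial smooth mollifiers. -/
lemma exists_radial_mollifier (hε : 0 < ε) :
    ∃ η : E2 → ℝ, ContDiff ℝ (⊤ : ℕ∞) η ∧ (∀ x, 0 ≤ η x) ∧ (∀ x, ε ≤ ‖x‖ → η x = 0) ∧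
      (∀ (ρ : E2 ≃ₗᵢ[ℝ] E2) x, η (ρ x) = η x) ∧ HasCompactSupport η ∧ ∫ x, η x = 1 := by
  set g : E2 → ℝ := fun x => Real.smoothTransition (1 + (-(ε ^ 2)⁻¹) * ‖x‖ ^ 2) with hg
  have hgs : ContDiff ℝ (⊤ : ℕ∞) g := contDiff_smoothTransition_normSq _ _
  have hg0 : ∀ x, 0 ≤ g x := fun x => Real.smoothTransition.nonneg _
  have hgz : ∀ x, ε ≤ ‖x‖ → g x = 0 := by
    intro x hx
    refine Real.smoothTransition.zero_of_nonpos ?_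
    have h1 : ε ^ 2 ≤ ‖x‖ ^ 2 := by gcongr
    have h2 : 1 ≤ (ε ^ 2)⁻¹ * ‖x‖ ^ 2 := by
      rw [inv_mul_eq_div, one_le_div (by positivity)]
      exact h1
    linarith
  have hgc : HasCompactSupport g := by
    refine HasCompactSupport.intro (isCompact_closedBall (0 : E2) ε) fun x hx => hgz x ?_
    simp only [Metric.mem_closedBall, dist_zero_right, not_le] at hx
    exact hx.le
  have hI : 0 < ∫ x, g x := by
    refine hgs.continuous.integral_pos_of_hasCompactSupport_nonneg_nonzero hgc hg0 (x := 0) ?_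
    simp [hg]
  refine ⟨fun x => (∫ y, g y)⁻¹ * g x, contDiff_const.mul hgs,
    fun x => mul_nonneg (by positivity) (hg0 x), fun x hx => by simp [hgz x hx], fun ρ x => ?_,
    hgc.mul_left, ?_⟩
  · simp only [hg, LinearIsometryEquiv.norm_map]
  · rw [integral_const_mul, inv_mul_cancel₀ hI.ne']

lemma hasFDerivAt_mollify {η : E2 → ℝ} (hη : Continuous η) (hηc : HasCompactSupport η)
    (hη0 : ∀ x, 0 ≤ η x) (hv : LipschitzWith C v) (x : E2) :
    HasFDerivAt (fun x => ∫ h, η h * v (x - h)) (∫ h, η h • fderiv ℝ v (x - h)) x := by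
  have hηI : Integrable η := hη.integrable_of_hasCompactSupport hηc
  have hae : ∀ᵐ h : E2, DifferentiableAt ℝ v (x - h) :=
    (quasiMeasurePreserving_sub_left volume x).ae hv.ae_differentiableAt
  have hmeas : ∀ y, Measurable fun h => η h * v (y - h) := fun y =>
    hη.measurable.mul (hv.continuous.measurable.comp (measurable_const.sub measurable_id))
  refine (hasFDerivAt_integral_of_dominated_loc_of_lip (F := fun y h => η h * v (y - h))
    (bound := fun h => η h * C)
    (Metric.ball_mem_nhds x one_pos) (Eventually.of_forall fun y => (hmeas y).aestronglyMeasurable)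
    ?_ ?_ ?_ (hηI.mul_const _) ?_).2
  · exact (hη.mul (hv.continuous.comp (by fun_prop))).integrable_of_hasCompactSupport
      hηc.mul_right
  · have h1 : Measurable fun h => fderiv ℝ v (x - h) :=
      (measurable_fderiv ℝ v).comp (measurable_const.sub measurable_id)
    exact (hη.measurable.smul h1).aestronglyMeasurable
  · refine Eventually.of_forall fun h => ?_
    refine LipschitzWith.lipschitzOnWith (LipschitzWith.of_dist_le_mul fun a b => ?_)
    have := hv.dist_le_mul (a - h) (b - h)
    rw [dist_sub_right] at this
    rw [Real.dist_eq, ← mul_sub, abs_mul, abs_of_nonneg (hη0 h), ← Real.dist_eq,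
      Real.coe_nnabs, abs_of_nonneg (mul_nonneg (hη0 h) C.coe_nonneg), mul_assoc]
    exact mul_le_mul_of_nonneg_left this (hη0 h)
  · filter_upwards [hae] with h hh
    have := (hh.hasFDerivAt.comp x ((hasFDerivAt_id x).sub_const h)).const_mul (η h)
    simpa using this

lemma lintegral_mollify_le {η : E2 → ℝ} (hη : Continuous η) (hηc : HasCompactSupport η)
    (hη0 : ∀ x, 0 ≤ η x) (hη1 : ∫ x, η x = 1) (hv : LipschitzWith C v) :
    ∫⁻ x, ENNReal.ofReal (‖fderiv ℝ (fun x => ∫ h, η h * v (x - h)) x‖ ^ 2) ≤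
      ∫⁻ x, ENNReal.ofReal (‖fderiv ℝ v x‖ ^ 2) := by
  have hηI : Integrable η := hη.integrable_of_hasCompactSupport hηc
  have hdm := measurable_fderiv ℝ v
  have hC : ∀ x, ‖fderiv ℝ v x‖ ≤ C := fun x => norm_fderiv_le_of_lipschitz ℝ hv
  have hpt : ∀ x, ENNReal.ofReal (‖fderiv ℝ (fun x => ∫ h, η h * v (x - h)) x‖ ^ 2) ≤
      ∫⁻ h, ENNReal.ofReal (η h) * ENNReal.ofReal (‖fderiv ℝ v (x - h)‖ ^ 2) := by
    intro x
    rw [(hasFDerivAt_mollify hη hηc hη0 hv x).fderiv]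
    set f : E2 → ℝ := fun h => ‖fderiv ℝ v (x - h)‖ with hf
    have hfm : Measurable f := (hdm.comp (measurable_const.sub measurable_id)).norm
    have hf0 : ∀ h, 0 ≤ f h := fun h => norm_nonneg _
    have hfC : ∀ h, f h ≤ C := fun h => hC _
    have i1 : Integrable fun h => η h * f h := by
      refine hηI.mul_bdd (c := C) hfm.aestronglyMeasurable (Eventually.of_forall fun h => ?_)
      rw [Real.norm_of_nonneg (hf0 h)]; exact hfC h
    have i2 : Integrable fun h => η h * f h ^ 2 := by
      refine hηI.mul_bdd (c := (C : ℝ) ^ 2) (hfm.pow_const 2).aestronglyMeasurable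
        (Eventually.of_forall fun h => ?_)
      rw [Real.norm_of_nonneg (by positivity)]
      exact pow_le_pow_left₀ (hf0 h) (hfC h) 2
    set m := ∫ h, η h * f h with hm
    have hvar : 0 ≤ ∫ h, η h * (f h - m) ^ 2 :=
      integral_nonneg fun h => mul_nonneg (hη0 h) (sq_nonneg _)
    have hexp : ∫ h, η h * (f h - m) ^ 2 = (∫ h, η h * f h ^ 2) - m ^ 2 := by
      have e : (fun h => η h * (f h - m) ^ 2) =
          fun h => (η h * f h ^ 2 - 2 * m * (η h * f h)) + m ^ 2 * η h := by
        funext h; ring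
      have i3 : Integrable fun h => 2 * m * (η h * f h) := i1.const_mul _
      have i4 : Integrable fun h => η h * f h ^ 2 - 2 * m * (η h * f h) := i2.sub i3
      rw [e, integral_add i4 (hηI.const_mul _), integral_sub i2 i3, integral_const_mul,
        integral_const_mul, hη1, ← hm]
      ring
    have hnm : ‖∫ h, η h • fderiv ℝ v (x - h)‖ ≤ m := by
      refine (norm_integral_le_integral_norm _).trans (le_of_eq ?_)
      refine integral_congr_ae (Eventually.of_forall fun h => ?_)
      simp only [norm_smul, Real.norm_of_nonneg (hη0 h), hf]
    have hle : ‖∫ h, η h • fderiv ℝ v (x - h)‖ ^ 2 ≤ ∫ h, η h * f h ^ 2 := by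
      have := pow_le_pow_left₀ (norm_nonneg _) hnm 2
      linarith
    refine (ENNReal.ofReal_le_ofReal hle).trans (le_of_eq ?_)
    rw [ofReal_integral_eq_lintegral_ofReal i2
      (Eventually.of_forall fun h => mul_nonneg (hη0 h) (sq_nonneg _))]
    exact lintegral_congr fun h => ENNReal.ofReal_mul (hη0 h)
  refine (lintegral_mono hpt).trans (le_of_eq ?_)
  rw [lintegral_lintegral_swap]
  · calc ∫⁻ h, ∫⁻ x, ENNReal.ofReal (η h) * ENNReal.ofReal (‖fderiv ℝ v (x - h)‖ ^ 2)
        = ∫⁻ h, ENNReal.ofReal (η h) * ∫⁻ x, ENNReal.ofReal (‖fderiv ℝ v x‖ ^ 2) := by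
          refine lintegral_congr fun h => ?_
          rw [lintegral_const_mul' _ _ ENNReal.ofReal_ne_top]
          congr 1
          exact lintegral_sub_right_eq_self
            (fun x => ENNReal.ofReal (‖fderiv ℝ v x‖ ^ 2)) h
      _ = _ := by
          rw [lintegral_mul_const _ hη.measurable.ennreal_ofReal,
            ← ofReal_integral_eq_lintegral_ofReal hηI (Eventually.of_forall hη0), hη1,
            ENNReal.ofReal_one, one_mul]
  · have h1 : Measurable fun p : E2 × E2 => fderiv ℝ v (p.1 - p.2) :=
      hdm.comp (measurable_fst.sub measurable_snd)
    exact ((hη.measurable.comp measurable_snd).ennreal_ofReal.mul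
      (h1.norm.pow_const 2).ennreal_ofReal).aemeasurable

lemma isTestFun_of_eq_zero (hR : R < 1) (hu : ContDiff ℝ (⊤ : ℕ∞) u)
    (h0 : ∀ x, R < ‖x‖ → u x = 0) : IsTestFun unitDisk u := by
  have hsub : tsupport u ⊆ Metric.closedBall 0 R := by
    refine closure_minimal (fun x hx => ?_) Metric.isClosed_closedBall
    by_contra hcon
    exact hx (h0 x (by simpa using hcon))
  exact ⟨hu, (isCompact_closedBall _ _).of_isClosed_subset (isClosed_tsupport _) hsub,
    hsub.trans (Metric.closedBall_subset_ball hR)⟩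

/-- A compactly supported radial Lipschitz function can be uniformly approximated by radial test
functions without increasing the Dirichlet energy. -/
theorem exists_mollification (hv : LipschitzWith C v) (hrad : ∃ f : ℝ → ℝ, ∀ x, v x = f ‖x‖)
    (hR : R < 1) (hsupp : ∀ x, R < ‖x‖ → v x = 0) {δ : ℝ} (hδ : 0 < δ) :
    ∃ w : E2 → ℝ, IsTestFun unitDisk w ∧ (∃ f : ℝ → ℝ, ∀ x, w x = f ‖x‖) ∧
      (∀ x, |w x - v x| ≤ δ) ∧ (∀ x, (1 + R) / 2 < ‖x‖ → w x = 0) ∧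
      ∫⁻ x in unitDisk, ENNReal.ofReal (‖fderiv ℝ w x‖ ^ 2) ≤
        ∫⁻ x in unitDisk, ENNReal.ofReal (‖fderiv ℝ v x‖ ^ 2) := by
  set ε := min ((1 - R) / 2) (δ / (C + 1)) with hεdef
  have hC1 : (0 : ℝ) < C + 1 := by positivity
  have hε : 0 < ε := lt_min (by linarith) (by positivity)
  have hε1 : ε ≤ (1 - R) / 2 := min_le_left _ _
  have hε2 : C * ε ≤ δ := by
    have : ε ≤ δ / (C + 1) := min_le_right _ _
    rw [le_div_iff₀ hC1] at this
    nlinarith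
  obtain ⟨η, hηs, hη0, hηz, hηrad, hηc, hη1⟩ := exists_radial_mollifier hε
  have hηI : Integrable η := hηs.continuous.integrable_of_hasCompactSupport hηc
  set w : E2 → ℝ := fun x => ∫ h, η h * v (x - h) with hw
  have hws : ContDiff ℝ (⊤ : ℕ∞) w :=
    hηc.contDiff_convolution_left (ContinuousLinearMap.mul ℝ ℝ) hηs
      hv.continuous.locallyIntegrable
  have hwz : ∀ x, (1 + R) / 2 < ‖x‖ → w x = 0 := by
    intro x hx
    rw [hw]
    refine integral_eq_zero_of_ae (Eventually.of_forall fun h => ?_)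
    rcases le_or_gt ε ‖h‖ with hh | hh
    · simp [hηz h hh]
    · have : v (x - h) = 0 := by
        refine hsupp _ ?_
        have := norm_sub_norm_le x h
        linarith
      simp [this]
  have hwrad : ∃ f : ℝ → ℝ, ∀ x, w x = f ‖x‖ := by
    refine exists_profile_of_comp_isometry fun ρ x => ?_
    obtain ⟨f, hf⟩ := hrad
    rw [hw]
    simp only
    rw [← ρ.measurePreserving.integral_comp ρ.toHomeomorph.measurableEmbedding]
    refine integral_congr_ae (Eventually.of_forall fun h => ?_)
    simp only [hηrad, ← map_sub, hf, LinearIsometryEquiv.norm_map]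
  refine ⟨w, isTestFun_of_eq_zero (by linarith) hws hwz, hwrad, fun x => ?_, hwz, ?_⟩
  · have i1 : Integrable fun h => η h * v (x - h) :=
      (hηs.continuous.mul (hv.continuous.comp (by fun_prop))).integrable_of_hasCompactSupport
        hηc.mul_right
    have e : w x - v x = ∫ h, η h * (v (x - h) - v x) := by
      have : (fun h => η h * (v (x - h) - v x)) = fun h => η h * v (x - h) - η h * v x := by
        funext h; ring
      rw [this, integral_sub i1 (hηI.mul_const _), integral_mul_const, hη1, one_mul]
    rw [e, ← Real.norm_eq_abs]
    have hb := norm_integral_le_of_norm_le (f := fun h => η h * (v (x - h) - v x))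
      (hηI.mul_const δ) (Eventually.of_forall fun h => ?_)
    · rwa [integral_mul_const, hη1, one_mul] at hb
    · rw [norm_mul, Real.norm_of_nonneg (hη0 h)]
      rcases le_or_gt ε ‖h‖ with hh | hh
      · simp [hηz h hh]
      · refine mul_le_mul_of_nonneg_left ?_ (hη0 h)
        have := hv.dist_le_mul (x - h) x
        rw [Real.dist_eq, dist_eq_norm, sub_sub_cancel_left, norm_neg] at this
        rw [Real.norm_eq_abs]
        exact this.trans ((mul_le_mul_of_nonneg_left hh.le C.2).trans hε2)
  · have hBall : ∫⁻ x in unitDisk, ENNReal.ofReal (‖fderiv ℝ v x‖ ^ 2) =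
        ∫⁻ x, ENNReal.ofReal (‖fderiv ℝ v x‖ ^ 2) := by
      refine setLIntegral_eq_of_support_subset fun x hx => ?_
      by_contra hcon
      refine hx ?_
      have hx1 : R < ‖x‖ := by
        have := mem_unitDisk.not.1 hcon
        linarith
      have hev : v =ᶠ[𝓝 x] fun _ => 0 := by
        filter_upwards [continuous_norm.continuousAt.eventually_const_lt hx1] with y hy
        exact hsupp y hy
      simp [hev.fderiv_eq]
    rw [hBall]
    exact (setLIntegral_le_lintegral _ _).trans
      (lintegral_mollify_le hηs.continuous hηc hη0 hη1 hv)

end Mollification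

section Functionals

variable {V : ℝ → ℝ} {u v : E2 → ℝ} {x : E2} {R ρ : ℝ}

/-- The potential `V(|x|)` on the punctured disk, extended by zero. -/
def radialWeight (V : ℝ → ℝ) : E2 → ℝ := (unitDisk \ {0}).indicator fun x => V ‖x‖

lemma norm_mem_Ioo (hx : x ∈ unitDisk \ {0}) : ‖x‖ ∈ Ioo (0 : ℝ) 1 :=
  ⟨norm_pos_iff.2 hx.2, mem_unitDisk.1 hx.1⟩

lemma measurable_radialWeight (hV : MemClassV V) : Measurable (radialWeight V) := by
  classical
  rw [radialWeight, ← piecewise_eq_indicator]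
  refine ContinuousOn.measurable_piecewise ?_ continuousOn_const
    (measurableSet_unitDisk.diff (measurableSet_singleton 0))
  exact hV.1.comp continuous_norm.continuousOn fun x hx => norm_mem_Ioo hx

lemma radialWeight_nonneg (hV : MemClassV V) (x : E2) : 0 ≤ radialWeight V x :=
  indicator_nonneg (fun _ hx => hV.2.1 _ (norm_mem_Ioo hx)) x

lemma radialWeight_antitone (hV : MemClassV V) : ∀ x ∈ unitDisk, ∀ y ∈ unitDisk, x ≠ 0 →
    ‖x‖ ≤ ‖y‖ →
      (1 - ‖y‖ ^ 2) ^ 2 * radialWeight V y ≤ (1 - ‖x‖ ^ 2) ^ 2 * radialWeight V x := by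
  intro x hx y hy hx0 hxy
  have hy0 : y ≠ 0 := norm_pos_iff.1 ((norm_pos_iff.2 hx0).trans_le hxy)
  rw [radialWeight, indicator_of_mem (show x ∈ unitDisk \ {0} from ⟨hx, hx0⟩),
    indicator_of_mem (show y ∈ unitDisk \ {0} from ⟨hy, hy0⟩)]
  exact hV.2.2 (norm_mem_Ioo ⟨hx, hx0⟩) (norm_mem_Ioo ⟨hy, hy0⟩) hxy

lemma radialWeight_le (hV : MemClassV V) (hρ : 0 < ρ) (hR : R < 1) (h1 : ρ ≤ ‖x‖)
    (h2 : ‖x‖ ≤ R) : radialWeight V x ≤ V ρ / (1 - R ^ 2) ^ 2 := by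
  have hx : x ∈ unitDisk \ {0} :=
    ⟨mem_unitDisk.2 (h2.trans_lt hR), norm_pos_iff.1 (hρ.trans_le h1)⟩
  have hρ1 : ρ ∈ Ioo (0 : ℝ) 1 := ⟨hρ, (h1.trans h2).trans_lt hR⟩
  have hR2 : 0 < 1 - R ^ 2 := by nlinarith [norm_nonneg x]
  have hVρ := hV.2.1 _ hρ1
  have hVx := hV.2.1 _ (norm_mem_Ioo hx)
  have hanti : (1 - ‖x‖ ^ 2) ^ 2 * V ‖x‖ ≤ (1 - ρ ^ 2) ^ 2 * V ρ :=
    hV.2.2 hρ1 (norm_mem_Ioo hx) h1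
  rw [radialWeight, indicator_of_mem hx, le_div_iff₀ (by positivity)]
  have e1 : (1 - R ^ 2) ^ 2 ≤ (1 - ‖x‖ ^ 2) ^ 2 := by gcongr
  have e2 : (1 - ρ ^ 2) ^ 2 ≤ 1 := by
    have := hρ1.2
    exact pow_le_one₀ (by nlinarith) (by nlinarith)
  nlinarith [mul_le_mul_of_nonneg_left e1 hVx, mul_le_mul_of_nonneg_right e2 hVρ]

/-- The Dirichlet energy as an extended nonnegative number. -/
def dirichlet (u : E2 → ℝ) : ℝ≥0∞ := ∫⁻ x in unitDisk, ENNReal.ofReal (‖fderiv ℝ u x‖ ^ 2)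

/-- The potential energy as an extended nonnegative number. -/
def potential (V : ℝ → ℝ) (u : E2 → ℝ) : ℝ≥0∞ :=
  ∫⁻ x in unitDisk, ENNReal.ofReal (radialWeight V x * u x ^ 2)

/-- The exponential energy as an extended nonnegative number. -/
def expEnergy (u : E2 → ℝ) : ℝ≥0∞ :=
  ∫⁻ x in unitDisk, ENNReal.ofReal (rexp (4 * π * u x ^ 2))

lemma lintegral_fderiv_ne_top (hu : ContDiff ℝ (⊤ : ℕ∞) u) (hc : HasCompactSupport u) :
    ∫⁻ x, ENNReal.ofReal (‖fderiv ℝ u x‖ ^ 2) ≠ ∞ := by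
  have h1 : Continuous (fderiv ℝ u) := hu.continuous_fderiv (by simp)
  have h2 : HasCompactSupport fun x => ‖fderiv ℝ u x‖ ^ 2 :=
    (hc.fderiv (𝕜 := ℝ)).comp_left (g := fun l => ‖l‖ ^ 2) (by simp)
  have h3 : Integrable fun x => ‖fderiv ℝ u x‖ ^ 2 :=
    (h1.norm.pow 2).integrable_of_hasCompactSupport h2
  rw [← ofReal_integral_eq_lintegral_ofReal h3 (Eventually.of_forall fun x => by positivity)]
  exact ENNReal.ofReal_ne_top

lemma dirichlet_ne_top (hu : IsTestFun unitDisk u) : dirichlet u ≠ ∞ :=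
  ((setLIntegral_le_lintegral _ _).trans_lt
    (lintegral_fderiv_ne_top hu.1 hu.2.1).lt_top).ne

lemma QV_eq (hV : MemClassV V) (hu : IsTestFun unitDisk u) :
    QV V u = (dirichlet u).toReal - (potential V u).toReal := by
  have h1 : Continuous (fderiv ℝ u) := hu.1.continuous_fderiv (by simp)
  have m1 : Measurable fun x => ‖fderiv ℝ u x‖ ^ 2 := (h1.norm.pow 2).measurable
  have m2 : Measurable fun x => radialWeight V x * u x ^ 2 :=
    (measurable_radialWeight hV).mul (hu.1.continuous.measurable.pow_const 2)
  rw [QV, dirichlet, potential, ← integral_eq_lintegral_of_nonneg_ae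
    (Eventually.of_forall fun x => by positivity) m1.aestronglyMeasurable,
    ← integral_eq_lintegral_of_nonneg_ae
    (Eventually.of_forall fun x => mul_nonneg (radialWeight_nonneg hV x) (sq_nonneg _))
    m2.aestronglyMeasurable]
  congr 1
  refine setIntegral_congr_ae measurableSet_unitDisk ?_
  have h0 : ∀ᵐ x : E2, x ∉ ({0} : Set E2) :=
    measure_eq_zero_iff_ae_notMem.1 (measure_singleton 0)
  filter_upwards [h0] with x hx hxB
  rw [radialWeight, indicator_of_mem (show x ∈ unitDisk \ {0} from ⟨hxB, hx⟩)]

lemma exists_abs_le (hu : IsTestFun unitDisk u) : ∃ N : ℝ, ∀ x, |u x| ≤ N :=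
  HasCompactSupport.exists_bound_of_continuous hu.2.1 hu.1.continuous

lemma ofReal_integral_exp (hu : IsTestFun unitDisk u) :
    ENNReal.ofReal (∫ x in unitDisk, rexp (4 * π * u x ^ 2)) = expEnergy u := by
  obtain ⟨N, hN⟩ := exists_abs_le hu
  have hc : Continuous fun x => rexp (4 * π * u x ^ 2) :=
    Real.continuous_exp.comp (continuous_const.mul (hu.1.continuous.pow 2))
  refine ofReal_integral_eq_lintegral_ofReal ?_ (Eventually.of_forall fun x => by positivity)
  refine Measure.integrableOn_of_bounded (M := rexp (4 * π * N ^ 2)) volume_unitDisk_ne_top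
    hc.measurable.aestronglyMeasurable (Eventually.of_forall fun x => ?_)
  rw [Real.norm_of_nonneg (by positivity)]
  have : u x ^ 2 ≤ N ^ 2 := by
    rw [← sq_abs]
    exact pow_le_pow_left₀ (abs_nonneg _) (hN x) 2
  gcongr

lemma expEnergy_le_of_tendsto {f : ℕ → E2 → ℝ} (hf : ∀ n, Measurable (f n))
    (h : ∀ x, Tendsto (fun n => f n x) atTop (𝓝 (v x))) {c : ℝ≥0∞}
    (hc : ∃ᶠ n in atTop, expEnergy (f n) ≤ c) : expEnergy v ≤ c := by
  have hlim : ∀ x, ENNReal.ofReal (rexp (4 * π * v x ^ 2)) =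
      liminf (fun n => ENNReal.ofReal (rexp (4 * π * f n x ^ 2))) atTop := fun x =>
    (ENNReal.tendsto_ofReal ((Real.continuous_exp.tendsto _).comp
      (((h x).pow 2).const_mul (4 * π)))).liminf_eq.symm
  unfold expEnergy
  simp_rw [hlim]
  refine (lintegral_liminf_le fun n => ?_).trans (liminf_le_of_frequently_le hc ?_)
  · have := hf n
    fun_prop
  · isBoundedDefault

lemma isTestFun_const_mul (hu : IsTestFun unitDisk u) (c : ℝ) :
    IsTestFun unitDisk fun x => c * u x := by
  have hsub : tsupport (fun x => c * u x) ⊆ tsupport u :=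
    closure_mono fun x hx hx0 => hx (by simp [hx0])
  exact ⟨contDiff_const.mul hu.1, hu.2.1.of_isClosed_subset (isClosed_tsupport _) hsub,
    hsub.trans hu.2.2⟩

lemma QV_const_mul (hu : IsTestFun unitDisk u) (c : ℝ) :
    QV V (fun x => c * u x) = c ^ 2 * QV V u := by
  have hd : Differentiable ℝ u := hu.1.differentiable (by simp)
  have e1 : ∀ x, ‖fderiv ℝ (fun x => c * u x) x‖ ^ 2 = c ^ 2 * ‖fderiv ℝ u x‖ ^ 2 := by
    intro x
    rw [fderiv_const_mul (hd x), norm_smul, mul_pow, Real.norm_eq_abs, sq_abs]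
  have e2 : ∀ x, V ‖x‖ * (c * u x) ^ 2 = c ^ 2 * (V ‖x‖ * u x ^ 2) := fun x => by ring
  simp only [QV, e1, e2, integral_const_mul]
  ring

end Functionals

section IntegrablePotential

variable {V : ℝ → ℝ} {u v : E2 → ℝ} {x : E2} {R N : ℝ} {C : ℝ≥0}

lemma lintegral_closedBall_ne_top (hV : MemClassV V) (hR : R < 1)
    (h : ∫⁻ x in Metric.closedBall 0 (1 / 2), ENNReal.ofReal (radialWeight V x) ≠ ∞) :
    ∫⁻ x in Metric.closedBall 0 R, ENNReal.ofReal (radialWeight V x) ≠ ∞ := by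
  have hsub : Metric.closedBall (0 : E2) R ⊆ Metric.closedBall 0 (1 / 2) ∪
      (Metric.closedBall 0 R \ Metric.closedBall 0 (1 / 2)) := by
    rw [union_sdiff_self]; exact subset_union_right
  refine (((lintegral_mono_set hsub).trans (lintegral_union_le _ _ _)).trans_lt
    (ENNReal.add_lt_top.2 ⟨h.lt_top, ?_⟩)).ne
  refine (setLIntegral_mono' (g := fun _ => ENNReal.ofReal (V (1 / 2) / (1 - R ^ 2) ^ 2))
    (Metric.isClosed_closedBall.measurableSet.diff Metric.isClosed_closedBall.measurableSet)
    fun x hx => ?_).trans_lt ?_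
  · have h1 : ‖x‖ ≤ R := by simpa using hx.1
    have h2 : 1 / 2 < ‖x‖ := by simpa using hx.2
    exact ENNReal.ofReal_le_ofReal (radialWeight_le hV (by norm_num) hR h2.le h1)
  · rw [setLIntegral_const]
    refine ENNReal.mul_lt_top ENNReal.ofReal_lt_top ?_
    exact (measure_mono sdiff_subset).trans_lt measure_closedBall_lt_top

lemma lintegral_indicator_const_ne_top
    (h : ∫⁻ x in Metric.closedBall 0 R, ENNReal.ofReal (radialWeight V x) ≠ ∞) (c : ℝ) :
    ∫⁻ x in unitDisk, (Metric.closedBall (0 : E2) R).indicator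
      (fun x => ENNReal.ofReal (radialWeight V x) * ENNReal.ofReal c) x ≠ ∞ := by
  refine ((setLIntegral_le_lintegral _ _).trans_lt ?_).ne
  rw [lintegral_indicator Metric.isClosed_closedBall.measurableSet,
    lintegral_mul_const' _ _ ENNReal.ofReal_ne_top]
  exact ENNReal.mul_lt_top h.lt_top ENNReal.ofReal_lt_top

lemma potential_integrand_le (hV : MemClassV V) {a : ℝ} (hle : |u x| ≤ N)
    (hsupp : a < ‖x‖ → u x = 0) :
    ENNReal.ofReal (radialWeight V x * u x ^ 2) ≤ (Metric.closedBall (0 : E2) a).indicator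
      (fun x => ENNReal.ofReal (radialWeight V x) * ENNReal.ofReal (N ^ 2)) x := by
  by_cases hx : x ∈ Metric.closedBall (0 : E2) a
  · rw [indicator_of_mem hx, ← ENNReal.ofReal_mul (radialWeight_nonneg hV x)]
    refine ENNReal.ofReal_le_ofReal (mul_le_mul_of_nonneg_left ?_ (radialWeight_nonneg hV x))
    rw [← sq_abs]
    exact pow_le_pow_left₀ (abs_nonneg _) hle 2
  · have : u x = 0 := hsupp (by simpa using hx)
    simp [this]

lemma admissible_abs (hu : IsTestFun unitDisk u) :
    ∃ R N L : ℝ, 0 ≤ R ∧ R < 1 ∧ 0 ≤ L ∧ Admissible R N L fun x => |u x| := by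
  obtain ⟨r, hr, hsub⟩ := exists_lt_subset_ball (isClosed_tsupport u) hu.2.2
  obtain ⟨N, hN⟩ := exists_abs_le hu
  obtain ⟨C, hC⟩ := hu.1.lipschitzWith_of_hasCompactSupport hu.2.1 (by simp)
  refine ⟨max r 0, N, C, le_max_right _ _, max_lt hr one_pos, C.2, fun x => abs_nonneg _, hN,
    fun x hx => ?_, fun x hx y hy => ?_⟩
  · have : x ∉ tsupport u := fun h => by
      have := hsub h
      rw [mem_ball_zero_iff] at this
      exact absurd ((le_max_left _ _).trans_lt hx) (by linarith)
    simp [image_eq_zero_of_notMem_tsupport this]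
  · have h1 := hC.dist_le_mul x y
    rw [Real.dist_eq, dist_eq_norm] at h1
    refine (abs_abs_sub_abs_le _ _).trans (h1.trans (mul_le_mul_of_nonneg_left ?_ C.2))
    refine Real.le_sqrt_of_sq_le ?_
    have hx' := one_sub_sq_pos hx
    have hy' := one_sub_sq_pos hy
    rw [hypSep, le_div_iff₀ (mul_pos hx' hy')]
    have h2 : (1 - ‖x‖ ^ 2) * (1 - ‖y‖ ^ 2) ≤ 1 :=
      mul_le_one₀ (by nlinarith [sq_nonneg ‖x‖]) hy'.le (by nlinarith [sq_nonneg ‖y‖])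
    nlinarith [sq_nonneg ‖x - y‖]

lemma nonlocalEnergy_abs_le {κ : ℝ → ℝ} (hκ : ∀ s, 0 ≤ κ s) (u : E2 → ℝ) :
    nonlocalEnergy κ (fun x => |u x|) ≤ nonlocalEnergy κ u := by
  refine lintegral_mono fun p => ENNReal.ofReal_le_ofReal
    (mul_le_mul_of_nonneg_left ?_ (hκ _))
  exact sq_le_sq.2 (abs_abs_sub_abs_le _ _)

/-- Approximation of a radial Lipschitz competitor by radial test functions. -/
lemma expEnergy_le_of_radial_lipschitz (hV : MemClassV V)
    (hint : ∫⁻ x in Metric.closedBall 0 (1 / 2), ENNReal.ofReal (radialWeight V x) ≠ ∞)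
    (hR : R < 1) (hv : LipschitzWith C v) (hrad : ∃ f : ℝ → ℝ, ∀ x, v x = f ‖x‖)
    (hN : ∀ x, |v x| ≤ N) (hsupp : ∀ x, R < ‖x‖ → v x = 0) (hD : dirichlet v ≠ ∞)
    (hQ : (dirichlet v).toReal - (potential V v).toReal ≤ 1) {c : ℝ≥0∞}
    (hc : ∀ w, IsTestFun unitDisk w → (∃ f : ℝ → ℝ, ∀ x, w x = f ‖x‖) → QV V w ≤ 1 →
      expEnergy w ≤ c) : expEnergy v ≤ c := by
  have hdelta : ∀ n : ℕ, 0 < 1 / ((n : ℝ) + 1) := fun n => by positivity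
  choose w hwt hwr hwv hws hwD using fun n => exists_mollification hv hrad hR hsupp (hdelta n)
  have hwlim : ∀ x, Tendsto (fun n => w n x) atTop (𝓝 (v x)) := by
    intro x
    rw [tendsto_iff_dist_tendsto_zero]
    exact squeeze_zero (fun _ => dist_nonneg) (fun n => hwv n x)
      tendsto_one_div_add_atTop_nhds_zero_nat
  have hwN : ∀ n x, |w n x| ≤ N + 1 := by
    intro n x
    have h1 : 1 / ((n : ℝ) + 1) ≤ 1 := by
      rw [div_le_one (by positivity)]
      linarith [n.cast_nonneg (α := ℝ)]
    have h2 := abs_sub_abs_le_abs_sub (w n x) (v x)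
    linarith [hwv n x, hN x]
  have hR' : (1 + R) / 2 < 1 := by linarith
  have hdom := lintegral_indicator_const_ne_top (lintegral_closedBall_ne_top hV hR' hint)
    ((N + 1) ^ 2)
  have hPlim : Tendsto (fun n => potential V (w n)) atTop (𝓝 (potential V v)) := by
    refine tendsto_lintegral_of_dominated_convergence _ (fun n => ?_)
      (fun n => Eventually.of_forall fun x => potential_integrand_le hV (hwN n x) (hws n x)) hdom
      (Eventually.of_forall fun x =>
        ENNReal.tendsto_ofReal (((hwlim x).pow 2).const_mul _))
    exact ((measurable_radialWeight hV).mul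
      ((hwt n).1.continuous.measurable.pow_const 2)).ennreal_ofReal
  have hPv : potential V v ≠ ∞ := by
    refine ((lintegral_mono fun x => potential_integrand_le hV (a := (1 + R) / 2)
      ((hN x).trans (by linarith : N ≤ N + 1)) fun h => hsupp x (by linarith)).trans_lt
      hdom.lt_top).ne
  have hPreal : Tendsto (fun n => (potential V (w n)).toReal) atTop
      (𝓝 (potential V v).toReal) := (ENNReal.tendsto_toReal hPv).comp hPlim
  have hDle : ∀ n, (dirichlet (w n)).toReal ≤ (dirichlet v).toReal := fun n =>
    ENNReal.toReal_mono hD (hwD n)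
  have key : ∀ k : ℕ, expEnergy (fun x => (1 - 1 / ((k : ℝ) + 1)) * v x) ≤ c := by
    intro k
    set θ := 1 - 1 / ((k : ℝ) + 1) with hθ
    have hθ0 : 0 ≤ θ := by
      have : 1 / ((k : ℝ) + 1) ≤ 1 := by
        rw [div_le_one (by positivity)]
        linarith [k.cast_nonneg (α := ℝ)]
      linarith
    have hθ1 : θ < 1 := by linarith [hdelta k]
    have hlim : Tendsto (fun n => θ ^ 2 * ((dirichlet v).toReal - (potential V (w n)).toReal))
        atTop (𝓝 (θ ^ 2 * ((dirichlet v).toReal - (potential V v).toReal))) :=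
      (hPreal.const_sub _).const_mul _
    have hlt : θ ^ 2 * ((dirichlet v).toReal - (potential V v).toReal) < 1 := by nlinarith
    refine expEnergy_le_of_tendsto (f := fun n x => θ * w n x)
      (fun n => ((hwt n).1.continuous.measurable).const_mul θ)
      (fun x => (hwlim x).const_mul θ) (Eventually.frequently ?_)
    filter_upwards [hlim.eventually_lt_const hlt] with n hn
    refine hc _ (isTestFun_const_mul (hwt n) θ) ?_ ?_
    · obtain ⟨f, hf⟩ := hwr n
      exact ⟨fun r => θ * f r, fun x => by rw [hf]⟩
    · rw [QV_const_mul (hwt n), QV_eq hV (hwt n)]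
      refine le_trans (mul_le_mul_of_nonneg_left ?_ (sq_nonneg θ)) hn.le
      linarith [hDle n]
  refine expEnergy_le_of_tendsto (f := fun k x => (1 - 1 / ((k : ℝ) + 1)) * v x)
    (fun k => hv.continuous.measurable.const_mul _) (fun x => ?_)
    (Eventually.of_forall key).frequently
  have := (tendsto_one_div_add_atTop_nhds_zero_nat (𝕜 := ℝ)).const_sub 1 |>.mul_const (v x)
  simpa using this

theorem expEnergy_le_of_integrable (hV : MemClassV V)
    (hint : ∫⁻ x in Metric.closedBall 0 (1 / 2), ENNReal.ofReal (radialWeight V x) ≠ ∞)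
    (hu : IsTestFun unitDisk u) (hQ : QV V u ≤ 1) {c : ℝ≥0∞}
    (hc : ∀ w, IsTestFun unitDisk w → (∃ f : ℝ → ℝ, ∀ x, w x = f ‖x‖) → QV V w ≤ 1 →
      expEnergy w ≤ c) : expEnergy u ≤ c := by
  obtain ⟨R, N, L, hR0, hR, hL, hadm⟩ := admissible_abs hu
  have hN : 0 ≤ N := (hadm.nonneg 0).trans (hadm.le 0)
  obtain ⟨v, hv, hrad, hP, hE, hκ⟩ := exists_symmetrization hR0 hR hL (radialWeight_nonneg hV)
    (measurable_radialWeight hV) (radialWeight_antitone hV)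
    (lintegral_closedBall_ne_top hV hR hint) hadm
  obtain ⟨C, hC⟩ := exists_lipschitzWith_of_admissible hR0 hR hL hN
  obtain ⟨C', hC'⟩ := hu.1.lipschitzWith_of_hasCompactSupport hu.2.1 (by simp)
  have hD : dirichlet v ≤ dirichlet u := dirichlet_le_of_nonlocalEnergy_le (hC v hv) hC'
    fun κ h1 h2 => (hκ κ h1 h2).trans (nonlocalEnergy_abs_le h2 u)
  have hP' : potential V u ≤ potential V v := by
    simp only [sq_abs] at hP
    exact hP
  have hE' : expEnergy u ≤ expEnergy v := by
    simp only [sq_abs, one_mul] at hE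
    exact hE
  have hvN : ∀ x, |v x| ≤ N := fun x => by rw [abs_of_nonneg (hv.nonneg x)]; exact hv.le x
  have hDv : dirichlet v ≠ ∞ := (hD.trans_lt (dirichlet_ne_top hu).lt_top).ne
  have hPv : potential V v ≠ ∞ :=
    ((lintegral_mono fun x => potential_integrand_le hV (hvN x) (hv.supp x)).trans_lt
      (lintegral_indicator_const_ne_top (lintegral_closedBall_ne_top hV hR hint) _).lt_top).ne
  refine hE'.trans (expEnergy_le_of_radial_lipschitz hV hint hR (hC v hv) hrad hvN hv.supp hDv
    ?_ hc)
  rw [QV_eq hV hu] at hQ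
  linarith [ENNReal.toReal_mono (dirichlet_ne_top hu) hD, ENNReal.toReal_mono hPv hP']

end IntegrablePotential

section SingularPotential

variable {V : ℝ → ℝ} {u v : E2 → ℝ} {x : E2} {R N : ℝ} {C : ℝ≥0}

/-- A radial smooth function equal to one on `‖x‖ ≤ a` and vanishing for `b ≤ ‖x‖`. -/
def radialCutoff (a b : ℝ) (x : E2) : ℝ :=
  Real.smoothTransition (b ^ 2 / (b ^ 2 - a ^ 2) + (-(b ^ 2 - a ^ 2)⁻¹) * ‖x‖ ^ 2)

lemma radialCutoff_nonneg (a b : ℝ) (x : E2) : 0 ≤ radialCutoff a b x :=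
  Real.smoothTransition.nonneg _

lemma radialCutoff_le_one (a b : ℝ) (x : E2) : radialCutoff a b x ≤ 1 :=
  Real.smoothTransition.le_one _

lemma contDiff_radialCutoff (a b : ℝ) : ContDiff ℝ (⊤ : ℕ∞) (radialCutoff a b) :=
  contDiff_smoothTransition_normSq _ _

lemma radialCutoff_eq_one {a b : ℝ} (ha : 0 ≤ a) (hab : a < b) (hx : ‖x‖ ≤ a) :
    radialCutoff a b x = 1 := by
  refine Real.smoothTransition.one_of_one_le ?_
  have h : 0 < b ^ 2 - a ^ 2 := by nlinarith
  have h2 : ‖x‖ ^ 2 ≤ a ^ 2 := by gcongr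
  have e : b ^ 2 / (b ^ 2 - a ^ 2) + (-(b ^ 2 - a ^ 2)⁻¹) * ‖x‖ ^ 2 =
    (b ^ 2 - ‖x‖ ^ 2) / (b ^ 2 - a ^ 2) := by field_simp; ring
  rw [e, one_le_div h]
  linarith

lemma radialCutoff_eq_zero {a b : ℝ} (ha : 0 ≤ a) (hab : a < b) (hx : b ≤ ‖x‖) :
    radialCutoff a b x = 0 := by
  refine Real.smoothTransition.zero_of_nonpos ?_
  have h : 0 < b ^ 2 - a ^ 2 := by nlinarith
  have h2 : b ^ 2 ≤ ‖x‖ ^ 2 := pow_le_pow_left₀ (ha.trans hab.le) hx 2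
  have e : b ^ 2 / (b ^ 2 - a ^ 2) + (-(b ^ 2 - a ^ 2)⁻¹) * ‖x‖ ^ 2 =
    (b ^ 2 - ‖x‖ ^ 2) / (b ^ 2 - a ^ 2) := by field_simp; ring
  rw [e]
  exact div_nonpos_of_nonpos_of_nonneg (by linarith) h.le

lemma hasCompactSupport_radialCutoff {a b : ℝ} (ha : 0 ≤ a) (hab : a < b) :
    HasCompactSupport (radialCutoff a b) := by
  refine HasCompactSupport.intro (isCompact_closedBall (0 : E2) b) fun x hx =>
    radialCutoff_eq_zero ha hab ?_
  simp only [Metric.mem_closedBall, dist_zero_right, not_le] at hx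
  exact hx.le

/-- A cutoff equal to one on `ball 0 (1 / 2)`, with the ball of radius `r` removed. -/
def annularCutoff (r : ℝ) (x : E2) : ℝ :=
  radialCutoff (1 / 2) (3 / 4) x * (1 - radialCutoff 1 2 (r⁻¹ • x))

lemma annularCutoff_of_le {r : ℝ} (hr : 0 < r) (hx : ‖x‖ ≤ r) : annularCutoff r x = 0 := by
  have : radialCutoff 1 2 (r⁻¹ • x) = 1 := by
    refine radialCutoff_eq_one zero_le_one one_lt_two ?_
    rw [norm_smul, norm_inv, Real.norm_of_nonneg hr.le, inv_mul_le_one₀ hr]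
    exact hx
  simp [annularCutoff, this]

lemma annularCutoff_eq_zero (r : ℝ) (hx : 3 / 4 ≤ ‖x‖) : annularCutoff r x = 0 := by
  rw [annularCutoff, radialCutoff_eq_zero (by norm_num) (by norm_num) hx, zero_mul]

lemma abs_annularCutoff_le (r : ℝ) (x : E2) : |annularCutoff r x| ≤ 1 := by
  have h1 := radialCutoff_nonneg (1 / 2) (3 / 4) x
  have h2 := radialCutoff_le_one (1 / 2) (3 / 4) x
  have h3 := radialCutoff_nonneg 1 2 (r⁻¹ • x)
  have h4 := radialCutoff_le_one 1 2 (r⁻¹ • x)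
  rw [annularCutoff, abs_of_nonneg (mul_nonneg h1 (by linarith))]
  exact mul_le_one₀ h2 (by linarith) (by linarith)

lemma isTestFun_annularCutoff (r : ℝ) : IsTestFun unitDisk (annularCutoff r) := by
  refine isTestFun_of_eq_zero (R := 3 / 4) (by norm_num) ?_
    fun x hx => annularCutoff_eq_zero r hx.le
  exact (contDiff_radialCutoff _ _).mul (contDiff_const.sub
    ((contDiff_radialCutoff 1 2).comp (contDiff_const_smul _)))

lemma annularCutoff_radial (r : ℝ) : ∃ f : ℝ → ℝ, ∀ x, annularCutoff r x = f ‖x‖ := by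
  refine exists_profile_of_comp_isometry fun ρ x => ?_
  simp only [annularCutoff, radialCutoff, norm_smul, LinearIsometryEquiv.norm_map]

lemma norm_fderiv_annularCutoff_le {r : ℝ} (hr : 0 < r) (x : E2) :
    ‖fderiv ℝ (annularCutoff r) x‖ ≤ ‖fderiv ℝ (radialCutoff (1 / 2) (3 / 4)) x‖ +
      r⁻¹ * ‖fderiv ℝ (radialCutoff 1 2) (r⁻¹ • x)‖ := by
  have d1 : DifferentiableAt ℝ (radialCutoff (1 / 2) (3 / 4)) x :=
    (contDiff_radialCutoff _ _).differentiable (by simp) x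
  have d2 : DifferentiableAt ℝ (radialCutoff 1 2) (r⁻¹ • x) :=
    (contDiff_radialCutoff _ _).differentiable (by simp) _
  have h2 : HasFDerivAt (fun x => radialCutoff 1 2 (r⁻¹ • x))
      (r⁻¹ • fderiv ℝ (radialCutoff 1 2) (r⁻¹ • x)) x := by
    have := d2.hasFDerivAt.comp x ((hasFDerivAt_id x).const_smul r⁻¹)
    simp only [ContinuousLinearMap.comp_smul, ContinuousLinearMap.comp_id] at this
    exact this
  have h3 := d1.hasFDerivAt.mul (h2.const_sub 1)
  have h4 : fderiv ℝ (annularCutoff r) x = _ := h3.fderiv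
  rw [h4]
  refine (norm_add_le _ _).trans ?_
  have e1 := radialCutoff_nonneg (1 / 2) (3 / 4) x
  have e2 := radialCutoff_le_one (1 / 2) (3 / 4) x
  have e3 := radialCutoff_nonneg 1 2 (r⁻¹ • x)
  have e4 := radialCutoff_le_one 1 2 (r⁻¹ • x)
  rw [norm_smul, norm_smul, norm_neg, norm_smul, Real.norm_of_nonneg e1,
    Real.norm_of_nonneg (by linarith : 0 ≤ 1 - radialCutoff 1 2 (r⁻¹ • x)),
    Real.norm_of_nonneg (by positivity : 0 ≤ r⁻¹), add_comm]
  have hr' : 0 ≤ r⁻¹ := by positivity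
  exact add_le_add (mul_le_of_le_one_left (norm_nonneg _) (by linarith))
    (mul_le_of_le_one_left (mul_nonneg hr' (norm_nonneg _)) e2)

lemma exists_dirichlet_annularCutoff_le :
    ∃ K : ℝ≥0∞, K ≠ ∞ ∧ ∀ r, 0 < r → dirichlet (annularCutoff r) ≤ K := by
  set φ := radialCutoff (1 / 2) (3 / 4)
  set χ := radialCutoff 1 2
  have hφ : ∫⁻ x, ENNReal.ofReal (‖fderiv ℝ φ x‖ ^ 2) ≠ ∞ :=
    lintegral_fderiv_ne_top (contDiff_radialCutoff _ _)
      (hasCompactSupport_radialCutoff (by norm_num) (by norm_num))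
  have hχ : ∫⁻ x, ENNReal.ofReal (‖fderiv ℝ χ x‖ ^ 2) ≠ ∞ :=
    lintegral_fderiv_ne_top (contDiff_radialCutoff _ _)
      (hasCompactSupport_radialCutoff zero_le_one one_lt_two)
  refine ⟨ENNReal.ofReal 2 * (∫⁻ x, ENNReal.ofReal (‖fderiv ℝ φ x‖ ^ 2)) +
    ENNReal.ofReal 2 * ∫⁻ x, ENNReal.ofReal (‖fderiv ℝ χ x‖ ^ 2),
    ENNReal.add_ne_top.2 ⟨ENNReal.mul_ne_top ENNReal.ofReal_ne_top hφ,
      ENNReal.mul_ne_top ENNReal.ofReal_ne_top hχ⟩, fun r hr => ?_⟩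
  have hscale : ∫⁻ x, ENNReal.ofReal (‖fderiv ℝ χ x‖ ^ 2) =
      ∫⁻ x, ENNReal.ofReal ((r⁻¹ * ‖fderiv ℝ χ (r⁻¹ • x)‖) ^ 2) := by
    rw [lintegral_eq_scale 0 (inv_pos.2 hr), ← lintegral_const_mul' _ _ ENNReal.ofReal_ne_top]
    refine lintegral_congr fun x => ?_
    rw [← ENNReal.ofReal_mul (by positivity), zero_add, mul_pow]
  have hm := measurable_fderiv ℝ φ
  rw [hscale, ← lintegral_const_mul' _ _ ENNReal.ofReal_ne_top,
    ← lintegral_const_mul' _ _ ENNReal.ofReal_ne_top, ← lintegral_add_left (by fun_prop)]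
  refine (setLIntegral_le_lintegral _ _).trans (lintegral_mono fun x => ?_)
  rw [← ENNReal.ofReal_mul zero_le_two, ← ENNReal.ofReal_mul zero_le_two,
    ← ENNReal.ofReal_add (by positivity) (by positivity)]
  refine ENNReal.ofReal_le_ofReal ?_
  have h1 := pow_le_pow_left₀ (norm_nonneg _) (norm_fderiv_annularCutoff_le hr x) 2
  nlinarith [sq_nonneg (‖fderiv ℝ φ x‖ - r⁻¹ * ‖fderiv ℝ χ (r⁻¹ • x)‖)]

lemma potential_annularCutoff_ne_top (hV : MemClassV V) {r : ℝ} (hr : 0 < r) :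
    potential V (annularCutoff r) ≠ ∞ := by
  refine ((lintegral_mono fun x => ENNReal.ofReal_le_ofReal
    (?_ : _ ≤ |V r| / (1 - (3 / 4) ^ 2) ^ 2)).trans_lt
    (setLIntegral_const_unitDisk_ne_top _).lt_top).ne
  rcases le_or_gt ‖x‖ r with h1 | h1
  · rw [annularCutoff_of_le hr h1]
    have : 0 ≤ |V r| / (1 - (3 / 4) ^ 2) ^ 2 := by positivity
    simpa using this
  rcases le_or_gt (3 / 4) ‖x‖ with h2 | h2
  · rw [annularCutoff_eq_zero r h2]
    have : 0 ≤ |V r| / (1 - (3 / 4) ^ 2) ^ 2 := by positivity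
    simpa using this
  · have h3 := radialWeight_le hV hr (by norm_num) h1.le h2.le
    have h4 : annularCutoff r x ^ 2 ≤ 1 := by
      rw [← sq_abs]
      exact pow_le_one₀ (abs_nonneg _) (abs_annularCutoff_le r x)
    refine (mul_le_of_le_one_right (radialWeight_nonneg hV x) h4).trans (h3.trans ?_)
    gcongr
    exact le_abs_self _

lemma exists_QV_neg (hV : MemClassV V)
    (hint : ∫⁻ x in Metric.closedBall 0 (1 / 2), ENNReal.ofReal (radialWeight V x) = ∞) :
    ∃ w, IsTestFun unitDisk w ∧ (∃ f : ℝ → ℝ, ∀ x, w x = f ‖x‖) ∧ QV V w < 0 := by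
  by_contra! hcon
  obtain ⟨K, hK, hKle⟩ := exists_dirichlet_annularCutoff_le
  have hpos : ∀ n : ℕ, 0 < 1 / ((n : ℝ) + 1) := fun n => by positivity
  have hP : ∀ n : ℕ, potential V (annularCutoff (1 / ((n : ℝ) + 1))) ≤ K := by
    intro n
    have h1 := hcon _ (isTestFun_annularCutoff (1 / ((n : ℝ) + 1))) (annularCutoff_radial _)
    rw [QV_eq hV (isTestFun_annularCutoff _), sub_nonneg,
      ENNReal.toReal_le_toReal (potential_annularCutoff_ne_top hV (hpos n))
      (dirichlet_ne_top (isTestFun_annularCutoff _))] at h1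
    exact h1.trans (hKle _ (hpos n))
  have hlim : ∀ x ∈ Metric.closedBall (0 : E2) (1 / 2), ENNReal.ofReal (radialWeight V x) =
      liminf (fun n : ℕ => ENNReal.ofReal
        (radialWeight V x * annularCutoff (1 / ((n : ℝ) + 1)) x ^ 2)) atTop := by
    intro x hx
    refine (Tendsto.liminf_eq ?_).symm
    rcases eq_or_ne x 0 with rfl | hx0
    · simp [radialWeight]
    have hx1 : ‖x‖ ≤ 1 / 2 := by simpa using hx
    refine tendsto_const_nhds.congr' ?_
    have h1 : ∀ᶠ n : ℕ in atTop, 1 / ((n : ℝ) + 1) < ‖x‖ / 2 :=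
      tendsto_one_div_add_atTop_nhds_zero_nat.eventually_lt_const
        (half_pos (norm_pos_iff.2 hx0))
    filter_upwards [h1] with n hn
    have h2 : radialCutoff 1 2 ((1 / ((n : ℝ) + 1))⁻¹ • x) = 0 := by
      refine radialCutoff_eq_zero zero_le_one one_lt_two ?_
      rw [norm_smul, norm_inv, Real.norm_of_nonneg (hpos n).le, inv_mul_eq_div,
        le_div_iff₀ (hpos n)]
      linarith
    rw [annularCutoff, h2, radialCutoff_eq_one (by norm_num) (by norm_num) hx1]
    simp
  refine absurd hint (ne_of_lt (lt_of_le_of_lt ?_ hK.lt_top))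
  rw [setLIntegral_congr_fun Metric.isClosed_closedBall.measurableSet hlim]
  refine (lintegral_liminf_le fun n => ?_).trans (liminf_le_of_frequently_le
    (Eventually.of_forall fun n => ?_).frequently (by isBoundedDefault))
  · exact ((measurable_radialWeight hV).mul
      ((isTestFun_annularCutoff _).1.continuous.measurable.pow_const 2)).ennreal_ofReal
  · exact (lintegral_mono_set (Metric.closedBall_subset_ball (by norm_num))).trans (hP n)

theorem eq_top_of_not_integrable (hV : MemClassV V)
    (hint : ∫⁻ x in Metric.closedBall 0 (1 / 2), ENNReal.ofReal (radialWeight V x) = ∞)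
    {c : ℝ≥0∞} (hc : ∀ w, IsTestFun unitDisk w → (∃ f : ℝ → ℝ, ∀ x, w x = f ‖x‖) →
      QV V w ≤ 1 → expEnergy w ≤ c) : c = ∞ := by
  obtain ⟨w, hw, ⟨f, hf⟩, hneg⟩ := exists_QV_neg hV hint
  set I := ∫⁻ x in unitDisk, ENNReal.ofReal (4 * π * w x ^ 2) with hI
  have hwm : Measurable w := hw.1.continuous.measurable
  have hI0 : I ≠ 0 := by
    intro h
    rw [hI, lintegral_eq_zero_iff (by fun_prop)] at h
    have : potential V w = 0 := by
      refine (lintegral_congr_ae ?_).trans lintegral_zero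
      filter_upwards [h] with x hx
      have hx' : 4 * π * w x ^ 2 ≤ 0 := by simpa using hx
      have : w x ^ 2 = 0 := by
        have := Real.pi_pos
        have h4 : (0 : ℝ) < 4 * π := by positivity
        exact le_antisymm (nonpos_of_mul_nonpos_right hx' h4) (sq_nonneg _)
      simp [this]
    rw [QV_eq hV hw, this] at hneg
    simp only [ENNReal.toReal_zero, sub_zero] at hneg
    exact absurd hneg (not_lt.2 ENNReal.toReal_nonneg)
  by_contra hct
  obtain ⟨n, hn⟩ := ENNReal.exists_nat_mul_gt hI0 hct
  refine absurd hn (not_lt.2 ?_)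
  refine le_trans ?_ (hc _ (isTestFun_const_mul hw (√n))
    ⟨fun r => √n * f r, fun x => by rw [hf]⟩ ?_)
  · rw [hI, ← ENNReal.ofReal_natCast, ← lintegral_const_mul' _ _ ENNReal.ofReal_ne_top]
    refine lintegral_mono fun x => ?_
    rw [← ENNReal.ofReal_mul n.cast_nonneg]
    refine ENNReal.ofReal_le_ofReal ?_
    have e : 4 * π * (√n * w x) ^ 2 = n * (4 * π * w x ^ 2) := by
      rw [mul_pow, Real.sq_sqrt n.cast_nonneg]; ring
    rw [e]
    linarith [Real.add_one_le_exp ((n : ℝ) * (4 * π * w x ^ 2))]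
  · rw [QV_const_mul hw]
    nlinarith [sq_nonneg √(n : ℝ)]

end SingularPotential

end HypSymm

/-- For `V ∈ 𝒱`, the Trudinger-Moser supremum under `Q_V(u) ≤ 1` equals
(in `[0,∞]`) the same supremum restricted to radially symmetric test functions. -/
theorem trudinger_moser_radial_reduction (V : ℝ → ℝ) (hV : MemClassV V) :
    sSup {c : ℝ≥0∞ | ∃ u : E2 → ℝ, IsTestFun unitDisk u ∧ QV V u ≤ 1 ∧
        c = ENNReal.ofReal (∫ x in unitDisk, Real.exp (4 * π * u x ^ 2))} =
    sSup {c : ℝ≥0∞ | ∃ u : E2 → ℝ, IsTestFun unitDisk u ∧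
        (∃ f : ℝ → ℝ, ∀ x : E2, u x = f ‖x‖) ∧ QV V u ≤ 1 ∧
        c = ENNReal.ofReal (∫ x in unitDisk, Real.exp (4 * π * u x ^ 2))} := by
  refine le_antisymm (sSup_le ?_) (sSup_le_sSup ?_)
  · rintro c ⟨u, hu, hQ, rfl⟩
    rw [HypSymm.ofReal_integral_exp hu]
    set S := sSup {c : ℝ≥0∞ | ∃ u : E2 → ℝ, IsTestFun unitDisk u ∧
        (∃ f : ℝ → ℝ, ∀ x : E2, u x = f ‖x‖) ∧ QV V u ≤ 1 ∧
        c = ENNReal.ofReal (∫ x in unitDisk, Real.exp (4 * π * u x ^ 2))}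
    have hS : ∀ w, IsTestFun unitDisk w → (∃ f : ℝ → ℝ, ∀ x, w x = f ‖x‖) → QV V w ≤ 1 →
        HypSymm.expEnergy w ≤ S := fun w hw hr hq =>
      le_sSup ⟨w, hw, hr, hq, (HypSymm.ofReal_integral_exp hw).symm⟩
    by_cases hint : ∫⁻ x in Metric.closedBall 0 (1 / 2),
        ENNReal.ofReal (HypSymm.radialWeight V x) = ∞
    · rw [HypSymm.eq_top_of_not_integrable hV hint hS]
      exact le_top
    · exact HypSymm.expEnergy_le_of_integrable hV hint hu hQ hS
  · rintro c ⟨u, hu, -, hQ, rfl⟩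
    exact ⟨u, hu, hQ, rfl⟩
end
end
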